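/- arXiv:0905.1476 — 3 statements merged into one kernel-verified Lean document; each statement's English description precedes it below -/
import Mathlib

section
/- There exist absolute constants 0 < c ≤ C such that for every holomorphic function f : 𝔻 → ℓ² on the open unit disk 𝔻 ⊂ ℂ with f(0) = 0 and f not identically zero, c · sup_{0<r<1} (1/(2π)) ∫_0^{2π} ‖f(re^{iθ})‖_{ℓ²} dθ ≤ ∫_𝔻 ( ‖f′(z)‖_{ℓ²}² / ‖f(z)‖_{ℓ²} ) log(1/|z|) dA(z) ≤ C · sup_{0<r<1} (1/(2π)) ∫_0^{2π} ‖f(re^{iθ})‖_{ℓ²} dθ, where dA is Lebesgue area measure on 𝔻 and the (extended-real-valued) integrand is defined arbitrarily on the (at most countable) zero set of f. -/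
open MeasureTheory Metric Set Complex
open scoped ENNReal Real

noncomputable section

/-- The `H¹(𝔻; ℓ²)` norm `sup_{0<r<1} (2π)⁻¹ ∫₀^{2π} ‖f(re^{iθ})‖ dθ`. -/
def h1Disk (f : ℂ → lp (fun _ : ℕ => ℂ) 2) : ℝ≥0∞ :=
  ⨆ (r : ℝ) (_ : r ∈ Ioo (0 : ℝ) 1),
    ENNReal.ofReal (2 * π)⁻¹ *
      ∫⁻ θ in Icc (0 : ℝ) (2 * π),
        ENNReal.ofReal ‖f ((r : ℂ) * Complex.exp (θ * Complex.I))‖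

section aux
set_option linter.unusedSectionVars false
variable {E : Type*} [NormedAddCommGroup E] [InnerProductSpace ℂ E]

lemma gi_inner {γ δ : ℝ → E} {v w : E} {t : ℝ} (h1 : HasDerivAt γ v t) (h2 : HasDerivAt δ w t) :
    HasDerivAt (fun s => (inner ℂ (γ s) (δ s)).re)
      ((inner ℂ (γ t) w).re + (inner ℂ v (δ t)).re) t := by
  have h := h1.inner ℂ h2
  have := Complex.reCLM.hasFDerivAt.comp_hasDerivAt t h
  exact this

lemma gi_nsq (x : E) : ‖x‖ ^ 2 = (inner ℂ x x).re := by
  have := inner_self_eq_norm_sq (𝕜 := ℂ) x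
  simpa using this.symm

lemma gi_d1 {γ : ℝ → E} {v : E} {t ε : ℝ} (hε : 0 < ε) (h1 : HasDerivAt γ v t) :
    HasDerivAt (fun s => √(‖γ s‖ ^ 2 + ε))
      ((inner ℂ (γ t) v).re / √(‖γ t‖ ^ 2 + ε)) t := by
  have h := (gi_inner h1 h1).add_const ε
  simp_rw [gi_nsq]
  have hp : (inner ℂ (γ t) (γ t)).re + ε ≠ 0 := by
    rw [← gi_nsq]; positivity
  refine (h.sqrt hp).congr_deriv ?_
  rw [← Complex.conj_re (inner ℂ v (γ t)), inner_conj_symm]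
  ring

lemma gi_d2 {γ γ1 : ℝ → E} {v : E} {t ε : ℝ} (hε : 0 < ε) (h1 : HasDerivAt γ (γ1 t) t)
    (h2 : HasDerivAt γ1 v t) :
    HasDerivAt (fun s => (inner ℂ (γ s) (γ1 s)).re / √(‖γ s‖ ^ 2 + ε))
      ((‖γ1 t‖ ^ 2 + (inner ℂ (γ t) v).re) / √(‖γ t‖ ^ 2 + ε)
        - (inner ℂ (γ t) (γ1 t)).re ^ 2 / √(‖γ t‖ ^ 2 + ε) ^ 3) t := by
  have hp : √(‖γ t‖ ^ 2 + ε) ≠ 0 := by positivity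
  refine ((gi_inner h1 h2).div (gi_d1 hε h1) hp).congr_deriv ?_
  rw [gi_nsq (γ1 t)]
  field_simp
  ring


/-- Smoothed norm. -/
def gU (f : ℂ → E) (ε : ℝ) (z : ℂ) : ℝ := √(‖f z‖ ^ 2 + ε)

/-- Its Laplacian. -/
def gL (f : ℂ → E) (ε : ℝ) (z : ℂ) : ℝ :=
  2 * ‖deriv f z‖ ^ 2 / gU f ε z - ‖inner ℂ (f z) (deriv f z)‖ ^ 2 / gU f ε z ^ 3

/-- first radial derivative -/
def gV (f : ℂ → E) (ε : ℝ) (e z : ℂ) : ℝ := (inner ℂ (f z) (e • deriv f z)).re / gU f ε z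

/-- second radial derivative -/
def gW (f : ℂ → E) (ε : ℝ) (e z : ℂ) : ℝ :=
  (‖e • deriv f z‖ ^ 2 + (inner ℂ (f z) (e ^ 2 • deriv (deriv f) z)).re) / gU f ε z
    - (inner ℂ (f z) (e • deriv f z)).re ^ 2 / gU f ε z ^ 3

/-- second angular derivative -/
def gT (f : ℂ → E) (ε : ℝ) (z : ℂ) : ℝ :=
  (‖(z * I) • deriv f z‖ ^ 2 +
    (inner ℂ (f z) ((z * I * I) • deriv f z + (z * I) ^ 2 • deriv (deriv f) z)).re) / gU f ε z
    - (inner ℂ (f z) ((z * I) • deriv f z)).re ^ 2 / gU f ε z ^ 3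

lemma gi_alg (f : ℂ → E) (ε : ℝ) (r : ℝ) (e : ℂ) (he : ‖e‖ = 1) :
    r * (gV f ε e (r * e) + r * gW f ε e (r * e)) + gT f ε (r * e) = r * (r * gL f ε (r * e)) := by
  unfold gV gW gT gL
  set z : ℂ := r * e with hz
  generalize gU f ε z = u
  set a := inner ℂ (f z) (deriv f z) with ha
  set b := inner ℂ (f z) (deriv (deriv f) z) with hb
  have h1 : ‖a‖ ^ 2 = a.re ^ 2 + a.im ^ 2 := by
    rw [Complex.sq_norm, Complex.normSq_apply]; ring
  have h2 : e.re ^ 2 + e.im ^ 2 = 1 := by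
    have : ‖e‖ ^ 2 = e.re ^ 2 + e.im ^ 2 := by rw [Complex.sq_norm, Complex.normSq_apply]; ring
    rw [← this, he]; norm_num
  have h3 : (r * (e * a).re) ^ 2 + (z * I * a).re ^ 2 = r ^ 2 * ‖a‖ ^ 2 := by
    rw [h1, hz]
    simp [Complex.mul_re, Complex.mul_im]
    linear_combination (r ^ 2 * (a.re ^ 2 + a.im ^ 2)) * h2
  have h4 : r * (e * a).re + r ^ 2 * (e ^ 2 * b).re + (z * I * I * a + (z * I) ^ 2 * b).re = 0 := by
    rw [hz]
    simp [Complex.mul_re, Complex.mul_im, pow_two]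
    ring
  have h5 : ‖z * I‖ ^ 2 = r ^ 2 := by simp [hz, he]
  simp only [inner_add_right, inner_smul_right, norm_smul, mul_pow, ← ha, ← hb, he, h5]
  rw [mul_pow] at h4
  linear_combination (1 / u) * h4 - (1 / u ^ 3) * h3

lemma gi_fd {f : ℂ → E} (hf : DifferentiableOn ℂ f (ball 0 1)) {z : ℂ} (hz : z ∈ ball (0 : ℂ) 1) :
    HasDerivAt f (deriv f z) z :=
  (hf.differentiableAt (isOpen_ball.mem_nhds hz)).hasDerivAt

lemma gi_rad {f : ℂ → E} (hf : DifferentiableOn ℂ f (ball 0 1)) {e : ℂ} {r : ℝ}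
    (hz : r * e ∈ ball (0 : ℂ) 1) :
    HasDerivAt (fun s : ℝ => f (s * e)) (e • deriv f (r * e)) r := by
  have h : HasDerivAt (fun s : ℝ => (s : ℂ) * e) e r := by
    simpa using (Complex.ofRealCLM.hasDerivAt (x := r)).mul_const e
  exact HasDerivAt.scomp r (gi_fd hf hz) h

lemma gi_ang0 (r θ : ℝ) : HasDerivAt (fun s : ℝ => (r : ℂ) * Complex.exp (s * I))
    ((r : ℂ) * Complex.exp (θ * I) * I) θ := by
  have h : HasDerivAt (fun s : ℝ => (s : ℂ) * I) I θ := by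
    simpa using (Complex.ofRealCLM.hasDerivAt (x := θ)).mul_const I
  simpa [mul_assoc] using h.cexp.const_mul (r : ℂ)

lemma gi_ang {f : ℂ → E} (hf : DifferentiableOn ℂ f (ball 0 1)) {r θ : ℝ}
    (hz : r * Complex.exp (θ * I) ∈ ball (0 : ℂ) 1) :
    HasDerivAt (fun s : ℝ => f (r * Complex.exp (s * I)))
      ((r * Complex.exp (θ * I) * I) • deriv f (r * Complex.exp (θ * I))) θ :=
  HasDerivAt.scomp θ (gi_fd hf hz) (gi_ang0 r θ)

variable [CompleteSpace E]

lemma gi_radU {f : ℂ → E} (hf : DifferentiableOn ℂ f (ball 0 1)) {e : ℂ} {r ε : ℝ} (hε : 0 < ε)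
    (hz : r * e ∈ ball (0 : ℂ) 1) :
    HasDerivAt (fun s : ℝ => gU f ε (s * e)) (gV f ε e (r * e)) r :=
  gi_d1 hε (gi_rad hf hz)

lemma gi_radV {f : ℂ → E} (hf : DifferentiableOn ℂ f (ball 0 1)) {e : ℂ} {r ε : ℝ} (hε : 0 < ε)
    (hz : r * e ∈ ball (0 : ℂ) 1) :
    HasDerivAt (fun s : ℝ => gV f ε e (s * e)) (gW f ε e (r * e)) r := by
  have h2 : HasDerivAt (fun s : ℝ => e • deriv f (s * e)) (e ^ 2 • deriv (deriv f) (r * e)) r := by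
    have := (gi_rad (hf.deriv isOpen_ball) hz).const_smul e
    rw [smul_smul, ← pow_two] at this
    exact this
  exact gi_d2 (γ := fun s : ℝ => f (s * e)) (γ1 := fun s : ℝ => e • deriv f (s * e))
    hε (gi_rad hf hz) h2

lemma gi_angT {f : ℂ → E} (hf : DifferentiableOn ℂ f (ball 0 1)) {r θ ε : ℝ} (hε : 0 < ε)
    (hz : r * Complex.exp (θ * I) ∈ ball (0 : ℂ) 1) :
    HasDerivAt (fun s : ℝ => gV f ε (r * Complex.exp (s * I) * I) (r * Complex.exp (s * I)))
      (gT f ε (r * Complex.exp (θ * I))) θ := by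
  have h2 := ((gi_ang0 r θ).mul_const I).smul (gi_ang (hf.deriv isOpen_ball) hz)
  rw [smul_smul, add_comm, ← pow_two] at h2
  exact gi_d2 (γ := fun s : ℝ => f (r * Complex.exp (s * I)))
    (γ1 := fun s : ℝ => (r * Complex.exp (s * I) * I) • deriv f (r * Complex.exp (s * I)))
    hε (gi_ang hf hz) h2

lemma gi_Upos {f : ℂ → E} {ε : ℝ} (hε : 0 < ε) (z : ℂ) : 0 < gU f ε z := by
  unfold gU; positivity

lemma gi_Ule {f : ℂ → E} {ε : ℝ} (hε : 0 < ε) (z : ℂ) : ‖f z‖ ≤ gU f ε z := by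
  unfold gU; apply Real.le_sqrt_of_sq_le; linarith

lemma gi_Llow {f : ℂ → E} {ε : ℝ} (hε : 0 < ε) (z : ℂ) :
    ‖deriv f z‖ ^ 2 / gU f ε z ≤ gL f ε z := by
  unfold gL
  have hu := gi_Upos (f := f) hε z
  have hl := gi_Ule (f := f) hε z
  have : ‖inner ℂ (f z) (deriv f z)‖ ^ 2 / gU f ε z ^ 3 ≤ ‖deriv f z‖ ^ 2 / gU f ε z := by
    have h1 : ‖inner ℂ (f z) (deriv f z)‖ ^ 2 ≤ (gU f ε z * ‖deriv f z‖) ^ 2 := by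
      gcongr
      exact (norm_inner_le_norm _ _).trans (by gcongr)
    calc _ ≤ (gU f ε z * ‖deriv f z‖) ^ 2 / gU f ε z ^ 3 := by gcongr
      _ = _ := by field_simp
  have h2 : 2 * ‖deriv f z‖ ^ 2 / gU f ε z = 2 * (‖deriv f z‖ ^ 2 / gU f ε z) := by ring
  linarith

lemma gi_Lup {f : ℂ → E} {ε : ℝ} (hε : 0 < ε) (z : ℂ) :
    gL f ε z ≤ 2 * (‖deriv f z‖ ^ 2 / gU f ε z) := by
  unfold gL
  have hu := gi_Upos (f := f) hε z
  have : 0 ≤ ‖inner ℂ (f z) (deriv f z)‖ ^ 2 / gU f ε z ^ 3 := by positivity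
  have h2 : 2 * ‖deriv f z‖ ^ 2 / gU f ε z = 2 * (‖deriv f z‖ ^ 2 / gU f ε z) := by ring
  linarith

lemma gi_Lnn {f : ℂ → E} {ε : ℝ} (hε : 0 < ε) (z : ℂ) : 0 ≤ gL f ε z :=
  le_trans (by have := gi_Upos (f := f) hε z; positivity) (gi_Llow hε z)

lemma gi_cU {f : ℂ → E} (hf : DifferentiableOn ℂ f (ball 0 1)) {ε : ℝ} (hε : 0 < ε)
  {X : Type*} [TopologicalSpace X] {s : Set X} {z : X → ℂ}
    (hz : ContinuousOn z s) (hm : MapsTo z s (ball 0 1)) :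
    ContinuousOn (fun x => gU f ε (z x)) s := by
  have h0 : ContinuousOn (fun x => f (z x)) s := hf.continuousOn.comp hz hm
  unfold gU
  exact ((h0.norm.pow 2).add continuousOn_const).sqrt

lemma gi_cV {f : ℂ → E} (hf : DifferentiableOn ℂ f (ball 0 1)) {ε : ℝ} (hε : 0 < ε)
  {X : Type*} [TopologicalSpace X] {s : Set X} {e z : X → ℂ}
    (he : ContinuousOn e s) (hz : ContinuousOn z s) (hm : MapsTo z s (ball 0 1)) :
    ContinuousOn (fun x => gV f ε (e x) (z x)) s := by
  have h0 : ContinuousOn (fun x => f (z x)) s := hf.continuousOn.comp hz hm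
  have h1 : ContinuousOn (fun x => deriv f (z x)) s :=
    (hf.deriv isOpen_ball).continuousOn.comp hz hm
  have hu := gi_cU hf hε hz hm
  unfold gV
  refine ContinuousOn.div ?_ hu (fun x _ => (gi_Upos hε _).ne')
  exact Complex.continuous_re.comp_continuousOn (h0.inner (he.smul h1))

lemma gi_cW {f : ℂ → E} (hf : DifferentiableOn ℂ f (ball 0 1)) {ε : ℝ} (hε : 0 < ε)
  {X : Type*} [TopologicalSpace X] {s : Set X} {e z : X → ℂ}
    (he : ContinuousOn e s) (hz : ContinuousOn z s) (hm : MapsTo z s (ball 0 1)) :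
    ContinuousOn (fun x => gW f ε (e x) (z x)) s := by
  have h0 : ContinuousOn (fun x => f (z x)) s := hf.continuousOn.comp hz hm
  have h1 : ContinuousOn (fun x => deriv f (z x)) s :=
    (hf.deriv isOpen_ball).continuousOn.comp hz hm
  have h2 : ContinuousOn (fun x => deriv (deriv f) (z x)) s :=
    ((hf.deriv isOpen_ball).deriv isOpen_ball).continuousOn.comp hz hm
  have hu := gi_cU hf hε hz hm
  unfold gW
  refine (ContinuousOn.div ?_ hu (fun x _ => (gi_Upos hε _).ne')).sub
    (ContinuousOn.div ?_ (hu.pow 3) (fun x _ => (pow_pos (gi_Upos hε _) 3).ne'))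
  · exact ((he.smul h1).norm.pow 2).add
      (Complex.continuous_re.comp_continuousOn (h0.inner ((he.pow 2).smul h2)))
  · exact (Complex.continuous_re.comp_continuousOn (h0.inner (he.smul h1))).pow 2

lemma gi_cT {f : ℂ → E} (hf : DifferentiableOn ℂ f (ball 0 1)) {ε : ℝ} (hε : 0 < ε)
  {X : Type*} [TopologicalSpace X] {s : Set X} {z : X → ℂ}
    (hz : ContinuousOn z s) (hm : MapsTo z s (ball 0 1)) :
    ContinuousOn (fun x => gT f ε (z x)) s := by
  have h0 : ContinuousOn (fun x => f (z x)) s := hf.continuousOn.comp hz hm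
  have h1 : ContinuousOn (fun x => deriv f (z x)) s :=
    (hf.deriv isOpen_ball).continuousOn.comp hz hm
  have h2 : ContinuousOn (fun x => deriv (deriv f) (z x)) s :=
    ((hf.deriv isOpen_ball).deriv isOpen_ball).continuousOn.comp hz hm
  have hu := gi_cU hf hε hz hm
  have hi : ContinuousOn (fun x => z x * I) s := hz.mul continuousOn_const
  unfold gT
  refine (ContinuousOn.div ?_ hu (fun x _ => (gi_Upos hε _).ne')).sub
    (ContinuousOn.div ?_ (hu.pow 3) (fun x _ => (pow_pos (gi_Upos hε _) 3).ne'))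
  · exact ((hi.smul h1).norm.pow 2).add
      (Complex.continuous_re.comp_continuousOn (h0.inner
        (((hi.mul continuousOn_const).smul h1).add ((hi.pow 2).smul h2))))
  · exact (Complex.continuous_re.comp_continuousOn (h0.inner (hi.smul h1))).pow 2

lemma gi_cL {f : ℂ → E} (hf : DifferentiableOn ℂ f (ball 0 1)) {ε : ℝ} (hε : 0 < ε)
  {X : Type*} [TopologicalSpace X] {s : Set X} {z : X → ℂ}
    (hz : ContinuousOn z s) (hm : MapsTo z s (ball 0 1)) :
    ContinuousOn (fun x => gL f ε (z x)) s := by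
  have h0 : ContinuousOn (fun x => f (z x)) s := hf.continuousOn.comp hz hm
  have h1 : ContinuousOn (fun x => deriv f (z x)) s :=
    (hf.deriv isOpen_ball).continuousOn.comp hz hm
  have hu := gi_cU hf hε hz hm
  unfold gL
  refine (ContinuousOn.div ?_ hu (fun x _ => (gi_Upos hε _).ne')).sub
    (ContinuousOn.div ?_ (hu.pow 3) (fun x _ => (pow_pos (gi_Upos hε _) 3).ne'))
  · exact continuousOn_const.mul (h1.norm.pow 2)
  · exact (h0.inner h1).norm.pow 2


lemma gi_ball {R r θ : ℝ} (hR1 : R < 1) (h0 : 0 ≤ r) (h1 : r ≤ R) :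
    (r : ℂ) * Complex.exp (θ * I) ∈ ball (0 : ℂ) 1 := by
  rw [mem_ball_zero_iff, norm_mul, Complex.norm_exp_ofReal_mul_I, Complex.norm_real, mul_one,
    Real.norm_of_nonneg h0]
  linarith

lemma gi_logint {R : ℝ} (hR : 0 < R) :
    IntegrableOn (fun r => Real.log (R / r)) (Ioo 0 R) := by
  have h : IntegrableOn (fun r => Real.log R - Real.log r) (Ioo 0 R) := by
    have : IntervalIntegrable (fun r => Real.log R - Real.log r) volume 0 R :=
      intervalIntegrable_const.sub intervalIntegral.intervalIntegrable_log'
    rw [intervalIntegrable_iff_integrableOn_Ioo_of_le hR.le] at this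
    exact this
  refine h.congr_fun (fun r hr => ?_) measurableSet_Ioo
  simp only
  rw [Real.log_div hR.ne' hr.1.ne']

lemma gi_int {R : ℝ} (hR : 0 < R) {g : ℝ × ℝ → ℝ} (hg : ContinuousOn g (Icc 0 R ×ˢ Icc (-π) π)) :
    Integrable (fun p : ℝ × ℝ => Real.log (R / p.1) * g p)
      ((volume.restrict (Ioo 0 R)).prod (volume.restrict (Ioo (-π) π))) := by
  obtain ⟨K, hK⟩ := (isCompact_Icc.prod isCompact_Icc).exists_bound_of_continuousOn hg
  have h1 : Integrable (fun p : ℝ × ℝ => Real.log (R / p.1))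
      ((volume.restrict (Ioo 0 R)).prod (volume.restrict (Ioo (-π) π))) :=
    Integrable.comp_fst (gi_logint hR) _
  have hsub : Ioo 0 R ×ˢ Ioo (-π) π ⊆ Icc 0 R ×ˢ Icc (-π) π :=
    prod_mono Ioo_subset_Icc_self Ioo_subset_Icc_self
  rw [Measure.prod_restrict] at h1 ⊢
  refine h1.mul_bdd (c := K) ?_ ?_
  · exact (hg.mono hsub).aestronglyMeasurable (measurableSet_Ioo.prod measurableSet_Ioo)
  · exact (ae_restrict_iff' (measurableSet_Ioo.prod measurableSet_Ioo)).2
      (Filter.Eventually.of_forall fun p hp => hK p (hsub hp))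

lemma gi_ftc {f : ℂ → E} (hf : DifferentiableOn ℂ f (ball 0 1)) {ε : ℝ} (hε : 0 < ε)
  {R : ℝ} (hR : 0 < R) (hR1 : R < 1)
    (θ : ℝ) :
    ∫ r in Ioo 0 R, Real.log (R / r) * (gV f ε (Complex.exp (θ * I)) (r * Complex.exp (θ * I))
      + r * gW f ε (Complex.exp (θ * I)) (r * Complex.exp (θ * I)))
    = gU f ε (R * Complex.exp (θ * I)) - gU f ε 0 := by
  set e := Complex.exp (θ * I) with he
  have hm : MapsTo (fun r : ℝ => (r : ℂ) * e) (Icc 0 R) (ball 0 1) := fun r hr =>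
    gi_ball hR1 hr.1 hr.2
  have hc : ContinuousOn (fun r : ℝ => (r : ℂ) * e) (Icc 0 R) := by fun_prop
  have hce : ContinuousOn (fun r : ℝ => e) (Icc 0 R) := continuousOn_const
  have cU := gi_cU hf hε hc hm
  have cV := gi_cV hf hε hce hc hm
  have cW := gi_cW hf hε hce hc hm
  have clog : Continuous (fun r : ℝ => r * Real.log R - r * Real.log r) :=
    (continuous_id.mul continuous_const).sub Real.continuous_mul_log
  have key := intervalIntegral.integral_eq_sub_of_hasDerivAt_of_le hR.le
    (f := fun r : ℝ => gU f ε (r * e) + (r * Real.log R - r * Real.log r) * gV f ε e (r * e))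
    (f' := fun r : ℝ => Real.log (R / r) * (gV f ε e (r * e) + r * gW f ε e (r * e)))
    (cU.add (clog.continuousOn.mul cV)) ?_ ?_
  · rw [intervalIntegral.integral_of_le hR.le, integral_Ioc_eq_integral_Ioo] at key
    rw [key]; simp
  · intro r hr
    have hz := hm (Ioo_subset_Icc_self hr)
    have h1 := gi_radU hf hε hz
    have h2 := gi_radV hf hε hz
    have h3 : HasDerivAt (fun r : ℝ => r * Real.log R - r * Real.log r)
        (Real.log R - (Real.log r + 1)) r := by
      refine HasDerivAt.sub ?_ (Real.hasDerivAt_mul_log hr.1.ne')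
      simpa using (hasDerivAt_id r).mul_const (Real.log R)
    refine (h1.add (h3.mul h2)).congr_deriv ?_
    rw [Real.log_div hR.ne' hr.1.ne']
    ring
  · rw [intervalIntegrable_iff_integrableOn_Ioo_of_le hR.le]
    obtain ⟨K, hK⟩ := isCompact_Icc.exists_bound_of_continuousOn (cV.add (continuousOn_id.mul cW))
    refine Integrable.mul_bdd (c := K) (gi_logint hR) ?_ ?_
    · exact ((cV.add (continuousOn_id.mul cW)).mono Ioo_subset_Icc_self).aestronglyMeasurable
        measurableSet_Ioo
    · exact (ae_restrict_iff' measurableSet_Ioo).2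
        (Filter.Eventually.of_forall fun p hp => hK p (Ioo_subset_Icc_self hp))

lemma gi_angint {f : ℂ → E} (hf : DifferentiableOn ℂ f (ball 0 1)) {ε : ℝ} (hε : 0 < ε)
  {R : ℝ} (hR : 0 < R) (hR1 : R < 1)
    {r : ℝ} (h0 : 0 < r) (h1 : r ≤ R) :
    ∫ θ in Ioo (-π) π, (gV f ε (Complex.exp (θ * I)) (r * Complex.exp (θ * I))
      + r * gW f ε (Complex.exp (θ * I)) (r * Complex.exp (θ * I)))
    = ∫ θ in Ioo (-π) π, r * gL f ε (r * Complex.exp (θ * I)) := by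
  have hpi : -π ≤ π := by linarith [Real.pi_pos]
  have hm : MapsTo (fun θ : ℝ => (r : ℂ) * Complex.exp (θ * I)) univ (ball 0 1) := fun θ _ =>
    gi_ball hR1 h0.le h1
  have hc : ContinuousOn (fun θ : ℝ => (r : ℂ) * Complex.exp (θ * I)) univ := by fun_prop
  have cT := continuousOn_univ.1 (gi_cT hf hε hc hm)
  have cL := continuousOn_univ.1 (gi_cL hf hε hc hm)
  have hT : ∫ θ in (-π)..π, gT f ε (r * Complex.exp (θ * I)) = 0 := by
    rw [intervalIntegral.integral_eq_sub_of_hasDerivAt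
      (fun θ _ => gi_angT hf hε (hm (mem_univ θ))) (cT.intervalIntegrable _ _)]
    have : Complex.exp (((-π : ℝ) : ℂ) * I) = Complex.exp (((π : ℝ) : ℂ) * I) := by
      rw [Complex.exp_pi_mul_I]; push_cast; rw [neg_mul, Complex.exp_neg, Complex.exp_pi_mul_I]
      norm_num
    rw [this, sub_self]
  rw [← integral_Ioc_eq_integral_Ioo, ← integral_Ioc_eq_integral_Ioo,
    ← intervalIntegral.integral_of_le hpi, ← intervalIntegral.integral_of_le hpi]
  have heq : ∀ θ : ℝ, gV f ε (Complex.exp (θ * I)) (r * Complex.exp (θ * I))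
      + r * gW f ε (Complex.exp (θ * I)) (r * Complex.exp (θ * I)) =
      r * gL f ε (r * Complex.exp (θ * I)) - r⁻¹ * gT f ε (r * Complex.exp (θ * I)) := by
    intro θ
    have := gi_alg f ε r (Complex.exp (θ * I)) (Complex.norm_exp_ofReal_mul_I θ)
    have hr := h0.ne'
    field_simp
    linear_combination this
  simp_rw [heq]
  rw [intervalIntegral.integral_sub ((cL.const_mul r).intervalIntegrable _ _)
    ((cT.const_mul _).intervalIntegrable _ _), intervalIntegral.integral_const_mul r⁻¹, hT]
  simp

lemma gi_intL {f : ℂ → E} (hf : DifferentiableOn ℂ f (ball 0 1)) {ε : ℝ} (hε : 0 < ε)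
  {R : ℝ} (hR : 0 < R) (hR1 : R < 1)
    : Integrable (fun p : ℝ × ℝ => Real.log (R / p.1) *
      (p.1 * gL f ε (p.1 * Complex.exp (p.2 * I))))
      ((volume.restrict (Ioo 0 R)).prod (volume.restrict (Ioo (-π) π))) := by
  have hm : MapsTo (fun p : ℝ × ℝ => (p.1 : ℂ) * Complex.exp (p.2 * I))
      (Icc 0 R ×ˢ Icc (-π) π) (ball 0 1) := fun p hp => gi_ball hR1 hp.1.1 hp.1.2
  have hc : ContinuousOn (fun p : ℝ × ℝ => (p.1 : ℂ) * Complex.exp (p.2 * I))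
      (Icc 0 R ×ˢ Icc (-π) π) := by fun_prop
  exact gi_int hR (continuousOn_fst.mul (gi_cL hf hε hc hm))

lemma gi_green {f : ℂ → E} (hf : DifferentiableOn ℂ f (ball 0 1)) {ε : ℝ} (hε : 0 < ε)
  {R : ℝ} (hR : 0 < R) (hR1 : R < 1)
    : ∫ p : ℝ × ℝ, Real.log (R / p.1) * (p.1 * gL f ε (p.1 * Complex.exp (p.2 * I)))
      ∂((volume.restrict (Ioo 0 R)).prod (volume.restrict (Ioo (-π) π)))
    = ∫ θ in Ioo (-π) π, (gU f ε (R * Complex.exp (θ * I)) - gU f ε 0) := by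
  have hm : MapsTo (fun p : ℝ × ℝ => (p.1 : ℂ) * Complex.exp (p.2 * I))
      (Icc 0 R ×ˢ Icc (-π) π) (ball 0 1) := fun p hp => gi_ball hR1 hp.1.1 hp.1.2
  have hc : ContinuousOn (fun p : ℝ × ℝ => (p.1 : ℂ) * Complex.exp (p.2 * I))
      (Icc 0 R ×ˢ Icc (-π) π) := by fun_prop
  have hce : ContinuousOn (fun p : ℝ × ℝ => Complex.exp (p.2 * I))
      (Icc 0 R ×ˢ Icc (-π) π) := by fun_prop
  have hB := gi_int hR ((gi_cV hf hε hce hc hm).add (continuousOn_fst.mul (gi_cW hf hε hce hc hm)))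
  rw [integral_prod _ (gi_intL hf hε hR hR1)]
  calc _ = ∫ r in Ioo 0 R, ∫ θ in Ioo (-π) π, Real.log (R / r) *
        (gV f ε (Complex.exp (θ * I)) (r * Complex.exp (θ * I))
          + r * gW f ε (Complex.exp (θ * I)) (r * Complex.exp (θ * I))) := by
        refine setIntegral_congr_fun measurableSet_Ioo (fun r hr => ?_)
        simp only
        rw [integral_const_mul (Real.log (R / r)), integral_const_mul (Real.log (R / r)),
          gi_angint hf hε hR hR1 hr.1 hr.2.le]
    _ = ∫ θ in Ioo (-π) π, ∫ r in Ioo 0 R, Real.log (R / r) *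
        (gV f ε (Complex.exp (θ * I)) (r * Complex.exp (θ * I))
          + r * gW f ε (Complex.exp (θ * I)) (r * Complex.exp (θ * I))) :=
        integral_integral_swap hB
    _ = _ := by
        simp_rw [gi_ftc hf hε hR hR1]

lemma gi_area {f : ℂ → E} (hf : DifferentiableOn ℂ f (ball 0 1)) {ε : ℝ} (hε : 0 < ε)
  {R : ℝ} (hR : 0 < R) (hR1 : R < 1)
    : ∫⁻ z in ball (0 : ℂ) R, ENNReal.ofReal (gL f ε z * Real.log (R / ‖z‖))
    = ENNReal.ofReal (∫ θ in Ioo (-π) π, (gU f ε (R * Complex.exp (θ * I)) - gU f ε 0)) := by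
  have hms : MeasurableSet (Ioo 0 R ×ˢ Ioo (-π) π) := measurableSet_Ioo.prod measurableSet_Ioo
  rw [← gi_green hf hε hR hR1, ofReal_integral_eq_lintegral_ofReal (gi_intL hf hε hR hR1),
    Measure.prod_restrict]
  · rw [← lintegral_indicator measurableSet_ball, ← Complex.lintegral_comp_polarCoord_symm,
      ← lintegral_indicator polarCoord.open_target.measurableSet, ← Measure.volume_eq_prod,
      ← lintegral_indicator hms]
    congr 1
    ext p
    have hs : Complex.polarCoord.symm p = p.1 * Complex.exp (p.2 * I) := by
      rw [Complex.polarCoord_symm_apply, Complex.exp_mul_I]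
      push_cast; rfl
    by_cases hp : p ∈ polarCoord.target
    · rw [indicator_of_mem hp, hs]
      rw [polarCoord_target] at hp
      have hp1 : 0 < p.1 := hp.1
      have hn : ‖(p.1 : ℂ) * Complex.exp (p.2 * I)‖ = p.1 := by
        rw [norm_mul, Complex.norm_exp_ofReal_mul_I, Complex.norm_real, mul_one,
          Real.norm_of_nonneg hp1.le]
      by_cases hpR : p.1 < R
      · rw [indicator_of_mem (show p ∈ Ioo 0 R ×ˢ Ioo (-π) π from ⟨⟨hp1, hpR⟩, hp.2⟩),
          indicator_of_mem (by rw [mem_ball_zero_iff, hn]; exact hpR), hn, smul_eq_mul,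
          ← ENNReal.ofReal_mul hp1.le]
        congr 1; ring
      · rw [indicator_of_notMem (by rw [mem_ball_zero_iff, hn]; exact hpR), smul_zero,
          indicator_of_notMem (fun h => hpR h.1.2)]
    · rw [indicator_of_notMem hp, indicator_of_notMem]
      intro h
      apply hp
      rw [polarCoord_target]
      exact ⟨h.1.1, h.2⟩
  · rw [Measure.prod_restrict]
    refine (ae_restrict_iff' hms).2 (Filter.Eventually.of_forall fun p hp => ?_)
    have h1 : 0 < p.1 := hp.1.1
    have h2 : 0 ≤ Real.log (R / p.1) := Real.log_nonneg ((one_le_div h1).2 hp.1.2.le)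
    exact mul_nonneg h2 (mul_nonneg h1.le (gi_Lnn hε _))


lemma gi_cont {f : ℂ → E} (hf : DifferentiableOn ℂ f (ball 0 1))
    {R : ℝ} (hR : 0 < R) (hR1 : R < 1) :
    Continuous (fun θ : ℝ => f (R * Complex.exp (θ * I))) := by
  have hm : MapsTo (fun θ : ℝ => (R : ℂ) * Complex.exp (θ * I)) univ (ball 0 1) := fun θ _ =>
    gi_ball hR1 hR.le le_rfl
  have hc : ContinuousOn (fun θ : ℝ => (R : ℂ) * Complex.exp (θ * I)) univ := by fun_prop
  exact continuousOn_univ.1 (hf.continuousOn.comp hc hm)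

lemma gi_intg {f : ℂ → E} (hf : DifferentiableOn ℂ f (ball 0 1))
    {R : ℝ} (hR : 0 < R) (hR1 : R < 1) {g : E → ℝ} (hg : Continuous g) :
    IntegrableOn (fun θ : ℝ => g (f (R * Complex.exp (θ * I)))) (Ioo (-π) π) :=
  ((hg.comp (gi_cont hf hR hR1)).integrableOn_Icc (a := -π) (b := π)).mono_set Ioo_subset_Icc_self

lemma gi_per {f : ℂ → E} (hf : DifferentiableOn ℂ f (ball 0 1))
    {R : ℝ} (hR : 0 < R) (hR1 : R < 1) :
    ∫⁻ θ in Icc (0 : ℝ) (2 * π), ENNReal.ofReal ‖f ((R : ℂ) * Complex.exp (θ * Complex.I))‖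
    = ENNReal.ofReal (∫ θ in Ioo (-π) π, ‖f (R * Complex.exp (θ * I))‖) := by
  have hc := (gi_cont hf hR hR1).norm
  rw [← ofReal_integral_eq_lintegral_ofReal (hc.integrableOn_Icc (a := 0) (b := 2 * π))
    (Filter.Eventually.of_forall fun _ => norm_nonneg _)]
  congr 1
  rw [← integral_Ioc_eq_integral_Ioo, integral_Icc_eq_integral_Ioc,
    ← intervalIntegral.integral_of_le (by linarith [Real.pi_pos]),
    ← intervalIntegral.integral_of_le (by linarith [Real.pi_pos])]
  have hp : Function.Periodic (fun θ : ℝ => ‖f ((R : ℂ) * Complex.exp (θ * I))‖) (2 * π) := by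
    intro θ
    simp only
    push_cast
    rw [add_mul, Complex.exp_periodic]
  have := hp.intervalIntegral_add_eq 0 (-π)
  rw [zero_add, show -π + 2 * π = π by ring] at this
  exact this

lemma gi_upper1 {f : ℂ → E} (hf : DifferentiableOn ℂ f (ball 0 1))
    (h0 : f 0 = 0) {ε : ℝ} (hε : 0 < ε) {R : ℝ} (hR : 0 < R) (hR1 : R < 1) :
    ∫⁻ z in ball (0 : ℂ) 1, ENNReal.ofReal (‖deriv f z‖ ^ 2 / gU f ε z * Real.log (R / ‖z‖))
    ≤ ENNReal.ofReal (∫ θ in Ioo (-π) π, ‖f (R * Complex.exp (θ * I))‖) := by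
  calc _ ≤ ∫⁻ z in ball (0 : ℂ) R, ENNReal.ofReal (gL f ε z * Real.log (R / ‖z‖)) := by
        rw [← lintegral_indicator measurableSet_ball, ← lintegral_indicator measurableSet_ball]
        refine lintegral_mono fun z => ?_
        have hu := gi_Upos (f := f) hε z
        by_cases hz : z ∈ ball (0 : ℂ) R
        · rw [indicator_of_mem hz, indicator_of_mem (ball_subset_ball hR1.le hz)]
          apply ENNReal.ofReal_le_ofReal
          rw [mem_ball_zero_iff] at hz
          have : 0 ≤ Real.log (R / ‖z‖) := by
            rcases eq_or_ne ‖z‖ 0 with h | h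
            · simp [h]
            · exact Real.log_nonneg ((one_le_div (by positivity)).2 hz.le)
          exact mul_le_mul_of_nonneg_right (gi_Llow hε z) this
        · rw [indicator_of_notMem hz]
          by_cases hz1 : z ∈ ball (0 : ℂ) 1
          · rw [indicator_of_mem hz1]
            rw [mem_ball_zero_iff, not_lt] at hz
            have : Real.log (R / ‖z‖) ≤ 0 :=
              Real.log_nonpos (by positivity) ((div_le_one (hR.trans_le hz)).2 hz)
            exact (ENNReal.ofReal_of_nonpos (mul_nonpos_of_nonneg_of_nonpos (by positivity) this)).le
          · rw [indicator_of_notMem hz1]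
    _ = _ := gi_area hf hε hR hR1
    _ ≤ _ := by
        apply ENNReal.ofReal_le_ofReal
        have hg : Continuous fun x : E => √(‖x‖ ^ 2 + ε) - gU f ε 0 := by fun_prop
        refine integral_mono (gi_intg hf hR hR1 hg) (gi_intg hf hR hR1 continuous_norm)
          (fun θ => ?_)
        simp only [gU, h0, norm_zero]
        have := Real.sqrt_nonneg ε
        have h2 := Real.sq_sqrt hε.le
        rw [sub_le_iff_le_add]
        refine Real.sqrt_le_iff.2 ⟨by positivity, ?_⟩
        norm_num
        nlinarith [norm_nonneg (f (R * Complex.exp (θ * I)))]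

lemma gi_upper {f : ℂ → E} (hf : DifferentiableOn ℂ f (ball 0 1))
    (h0 : f 0 = 0) (A : ℝ≥0∞) (hA : ∀ R : ℝ, 0 < R → R < 1 →
      ENNReal.ofReal (∫ θ in Ioo (-π) π, ‖f (R * Complex.exp (θ * I))‖) ≤ A) :
    ∫⁻ z in ball (0 : ℂ) 1, ENNReal.ofReal (‖deriv f z‖ ^ 2 / ‖f z‖ * Real.log (1 / ‖z‖)) ≤ A := by
  let Eps : ℕ → ℝ := fun n => 1 / ((n : ℝ) + 1)
  let Rad : ℕ → ℝ := fun n => 1 - Eps n / 2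
  have hE : Filter.Tendsto Eps Filter.atTop (nhds 0) := tendsto_one_div_add_atTop_nhds_zero_nat
  have hRt : Filter.Tendsto Rad Filter.atTop (nhds 1) := by
    simpa using (hE.div_const 2).const_sub 1
  have hE0 : ∀ n, 0 < Eps n := fun n => by positivity
  have hE1 : ∀ n, Eps n ≤ 1 := fun n => by
    simp only [Eps]
    rw [div_le_one (by positivity)]
    linarith [(Nat.cast_nonneg n : (0 : ℝ) ≤ n)]
  have hR0 : ∀ n, 0 < Rad n := fun n => by have := hE1 n; simp only [Rad]; linarith
  have hR1 : ∀ n, Rad n < 1 := fun n => by have := hE0 n; simp only [Rad]; linarith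
  calc _ ≤ ∫⁻ z in ball (0 : ℂ) 1, Filter.liminf (fun n =>
          ENNReal.ofReal (‖deriv f z‖ ^ 2 / gU f (Eps n) z * Real.log (Rad n / ‖z‖))) Filter.atTop := by
        refine lintegral_mono fun z => ?_
        by_cases hz : f z = 0
        · simp [hz]
        · have hz0 : ‖z‖ ≠ 0 := by
            intro h; apply hz; rw [norm_eq_zero.1 h, h0]
          refine (Filter.Tendsto.liminf_eq ?_).ge
          refine ENNReal.tendsto_ofReal (Filter.Tendsto.mul ?_ ?_)
          · refine Filter.Tendsto.div tendsto_const_nhds ?_ (norm_ne_zero_iff.2 hz)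
            have : Filter.Tendsto (fun n => √(‖f z‖ ^ 2 + Eps n)) Filter.atTop
                (nhds √(‖f z‖ ^ 2 + 0)) := (tendsto_const_nhds.add hE).sqrt
            simpa [gU] using this
          · exact (hRt.div_const _).log (by simpa using hz0)
    _ ≤ Filter.liminf (fun n => ∫⁻ z in ball (0 : ℂ) 1,
          ENNReal.ofReal (‖deriv f z‖ ^ 2 / gU f (Eps n) z * Real.log (Rad n / ‖z‖))) Filter.atTop := by
        refine lintegral_liminf_le' fun n => ?_
        refine AEMeasurable.ennreal_ofReal (AEMeasurable.mul ?_ ?_)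
        · refine ContinuousOn.aemeasurable ?_ measurableSet_ball
          exact ((hf.deriv isOpen_ball).continuousOn.norm.pow 2).div
            (gi_cU hf (hE0 n) continuousOn_id (mapsTo_id _)) (fun z _ => (gi_Upos (hE0 n) z).ne')
        · exact (by fun_prop : Measurable fun z : ℂ => Real.log (Rad n / ‖z‖)).aemeasurable
    _ ≤ A := by
        refine Filter.liminf_le_of_le (by isBoundedDefault) fun b hb => ?_
        obtain ⟨n, hn⟩ := hb.exists
        exact hn.trans ((gi_upper1 hf h0 (hE0 n) (hR0 n) (hR1 n)).trans (hA _ (hR0 n) (hR1 n)))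

lemma gi_null {f : ℂ → E} (hf : DifferentiableOn ℂ f (ball 0 1))
    (hne : ∃ z ∈ ball (0 : ℂ) 1, f z ≠ 0) :
    ∀ᵐ z ∂(volume.restrict (ball (0 : ℂ) 1)), f z ≠ 0 := by
  obtain ⟨x, hx, hfx⟩ := hne
  have h := (hf.analyticOnNhd isOpen_ball).preimage_zero_mem_codiscreteWithin hfx hx
    ((convex_ball (0 : ℂ) 1).isConnected ⟨0, by simp⟩)
  exact ae_restrict_le_codiscreteWithin measurableSet_ball h

lemma gi_lower {f : ℂ → E} (hf : DifferentiableOn ℂ f (ball 0 1))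
    (h0 : f 0 = 0) (hne : ∃ z ∈ ball (0 : ℂ) 1, f z ≠ 0)
    {R : ℝ} (hR : 0 < R) (hR1 : R < 1) :
    ENNReal.ofReal (∫ θ in Ioo (-π) π, ‖f (R * Complex.exp (θ * I))‖) ≤
    2 * ∫⁻ z in ball (0 : ℂ) 1, ENNReal.ofReal (‖deriv f z‖ ^ 2 / ‖f z‖ * Real.log (1 / ‖z‖)) := by
  have key : ∀ δ : ℝ, 0 < δ →
      ENNReal.ofReal (∫ θ in Ioo (-π) π, ‖f (R * Complex.exp (θ * I))‖) ≤
      2 * (∫⁻ z in ball (0 : ℂ) 1, ENNReal.ofReal (‖deriv f z‖ ^ 2 / ‖f z‖ * Real.log (1 / ‖z‖)))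
        + ENNReal.ofReal (2 * π * δ) := by
    intro δ hδ
    have hε : 0 < δ ^ 2 := by positivity
    have h1 : ENNReal.ofReal (∫ θ in Ioo (-π) π,
          (gU f (δ ^ 2) (R * Complex.exp (θ * I)) - gU f (δ ^ 2) 0)) ≤
        2 * ∫⁻ z in ball (0 : ℂ) 1,
          ENNReal.ofReal (‖deriv f z‖ ^ 2 / ‖f z‖ * Real.log (1 / ‖z‖)) := by
      rw [← gi_area hf hε hR hR1, ← lintegral_const_mul' _ _ (by simp)]
      refine (lintegral_mono_ae ?_).trans (lintegral_mono_set (ball_subset_ball hR1.le))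
      have hnull := ae_restrict_of_ae_restrict_of_subset (ball_subset_ball hR1.le)
        (gi_null hf hne)
      filter_upwards [hnull, ae_restrict_mem measurableSet_ball] with z hz hzR
      rw [show (2 : ℝ≥0∞) = ENNReal.ofReal 2 by simp, ← ENNReal.ofReal_mul (by norm_num),
        ← mul_assoc]
      apply ENNReal.ofReal_le_ofReal
      have hz0 : 0 < ‖z‖ := by
        rw [norm_pos_iff]; intro h; apply hz; rw [h, h0]
      have hfz : 0 < ‖f z‖ := norm_pos_iff.2 hz
      rw [mem_ball_zero_iff] at hzR
      have hl0 : 0 ≤ Real.log (R / ‖z‖) := Real.log_nonneg ((one_le_div hz0).2 hzR.le)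
      have hl1 : Real.log (R / ‖z‖) ≤ Real.log (1 / ‖z‖) :=
        Real.log_le_log (by positivity) (by gcongr)
      refine mul_le_mul ?_ hl1 hl0 (by positivity)
      refine (gi_Lup hε z).trans ?_
      have := gi_Ule (f := f) hε z
      gcongr
    have h2 : ∫ θ in Ioo (-π) π, ‖f (R * Complex.exp (θ * I))‖ ≤
        (∫ θ in Ioo (-π) π,
          (gU f (δ ^ 2) (R * Complex.exp (θ * I)) - gU f (δ ^ 2) 0)) + 2 * π * δ := by
      have hg : Continuous fun x : E => √(‖x‖ ^ 2 + δ ^ 2) - gU f (δ ^ 2) 0 := by fun_prop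
      have hi := gi_intg hf hR hR1 hg
      have hv : ∫ θ in Ioo (-π) π, δ = 2 * π * δ := by
        rw [setIntegral_const, Measure.real, Real.volume_Ioo,
          ENNReal.toReal_ofReal (by linarith [Real.pi_pos]), smul_eq_mul]
        ring
      rw [← hv]
      refine le_trans ?_ (integral_add hi (integrable_const δ)).le
      refine integral_mono (gi_intg hf hR hR1 continuous_norm) (hi.add (integrable_const δ))
        (fun θ => ?_)
      have hz : gU f (δ ^ 2) 0 = δ := by simp [gU, h0, Real.sqrt_sq hδ.le]
      have := gi_Ule (f := f) hε (R * Complex.exp (θ * I))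
      simp only [gU] at this
      simp only [hz]
      linarith
    calc _ ≤ _ := ENNReal.ofReal_le_ofReal h2
      _ ≤ _ := ENNReal.ofReal_add_le
      _ ≤ _ := by gcongr
  have ht : Filter.Tendsto (fun δ : ℝ =>
      2 * (∫⁻ z in ball (0 : ℂ) 1, ENNReal.ofReal (‖deriv f z‖ ^ 2 / ‖f z‖ * Real.log (1 / ‖z‖)))
        + ENNReal.ofReal (2 * π * δ)) (nhdsWithin 0 (Ioi 0)) (nhds (
      2 * (∫⁻ z in ball (0 : ℂ) 1, ENNReal.ofReal (‖deriv f z‖ ^ 2 / ‖f z‖ * Real.log (1 / ‖z‖)))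
        + ENNReal.ofReal (2 * π * 0))) := by
    refine Filter.Tendsto.add tendsto_const_nhds (ENNReal.tendsto_ofReal ?_)
    exact ((continuous_const.mul continuous_id).tendsto (0 : ℝ)).mono_left nhdsWithin_le_nhds
  have := ge_of_tendsto ht (Filter.eventually_of_mem self_mem_nhdsWithin fun δ hδ => key δ hδ)
  simpa using this


end aux

/-- For holomorphic `f : 𝔻 → ℓ²` with `f(0) = 0` and `f ≢ 0`,
`∫_𝔻 (‖f′(z)‖²/‖f(z)‖) log(1/|z|) dA(z)` is comparable to the `H¹(𝔻;ℓ²)` norm of `f`,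
with absolute constants `0 < c ≤ C`. -/
theorem h1_green_identity_disk :
    ∃ c C : ℝ, 0 < c ∧ c ≤ C ∧
      ∀ f : ℂ → lp (fun _ : ℕ => ℂ) 2,
        DifferentiableOn ℂ f (ball (0 : ℂ) 1) →
        f 0 = 0 →
        (∃ z ∈ ball (0 : ℂ) 1, f z ≠ 0) →
        ENNReal.ofReal c * h1Disk f ≤
            (∫⁻ z in ball (0 : ℂ) 1,
              ENNReal.ofReal
                (‖deriv f z‖ ^ 2 / ‖f z‖ * Real.log (1 / ‖z‖)) ∂volume) ∧
          (∫⁻ z in ball (0 : ℂ) 1,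
              ENNReal.ofReal
                (‖deriv f z‖ ^ 2 / ‖f z‖ * Real.log (1 / ‖z‖)) ∂volume) ≤
            ENNReal.ofReal C * h1Disk f := by
  have hpi := Real.pi_pos
  refine ⟨π, 2 * π, hpi, by linarith, fun f hf h0 hne => ⟨?_, ?_⟩⟩
  · unfold h1Disk
    simp_rw [ENNReal.mul_iSup]
    refine iSup₂_le fun R hR => ?_
    rw [gi_per hf hR.1 hR.2, ← mul_assoc, ← ENNReal.ofReal_mul hpi.le]
    calc _ ≤ ENNReal.ofReal (π * (2 * π)⁻¹) * (2 * _) :=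
          mul_le_mul_right (gi_lower hf h0 hne hR.1 hR.2) _
      _ = _ := by
        have h2 : ENNReal.ofReal (π * (2 * π)⁻¹) * 2 = 1 := by
          rw [show (2 : ℝ≥0∞) = ENNReal.ofReal 2 by simp, ← ENNReal.ofReal_mul (by positivity),
            show π * (2 * π)⁻¹ * 2 = 1 by field_simp, ENNReal.ofReal_one]
        rw [← mul_assoc, h2, one_mul]
  · refine gi_upper hf h0 _ fun R hR hR1 => ?_
    have h : ENNReal.ofReal (2 * π)⁻¹ *
      ∫⁻ θ in Icc (0 : ℝ) (2 * π), ENNReal.ofReal ‖f ((R : ℂ) * Complex.exp (θ * Complex.I))‖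
        ≤ h1Disk f := by
      unfold h1Disk
      exact le_iSup₂_of_le R ⟨hR, hR1⟩ le_rfl
    calc _ = ENNReal.ofReal (2 * π) * (ENNReal.ofReal (2 * π)⁻¹ *
      ∫⁻ θ in Icc (0 : ℝ) (2 * π), 
        ENNReal.ofReal ‖f ((R : ℂ) * Complex.exp (θ * Complex.I))‖) := by
          rw [gi_per hf hR hR1, ← mul_assoc, ← ENNReal.ofReal_mul (by positivity),
            mul_inv_cancel₀ (by positivity)]
          simp
      _ ≤ _ := mul_le_mul_right h _
end
end

section
/- There is a constant C = C(n) such that for every holomorphic function f : B_n → ℓ² that is not identically zero, ∫_{B_n} ( ‖Rf(z)‖_{ℓ²}² / ‖f(z)‖_{ℓ²} ) |z|^{−2n} log(1/|z|) dV(z) ≤ C · sup_{0<r<1} ∫_{∂B_n} ‖f(rζ)‖_{ℓ²} dσ(ζ), where Rf(z) = Σ_{j=1}^n z_j ∂f/∂z_j(z) is the radial derivative and the extended-real-valued integrand is defined arbitrarily on the zero set of f. -/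
open MeasureTheory Metric Set Complex Topology
open scoped ENNReal NNReal

noncomputable section

/-- `ℂⁿ` with the Euclidean (Hermitian) norm: the ball `B_n` is `Metric.ball 0 1`. -/
abbrev En (n : ℕ) : Type := EuclideanSpace ℂ (Fin n)

instance (n : ℕ) : MeasurableSpace (En n) := borel _
instance (n : ℕ) : BorelSpace (En n) := ⟨rfl⟩

/-- The Hilbert space `ℓ²` of square-summable complex sequences. -/
abbrev l2 : Type := lp (fun _ : ℕ => ℂ) 2

/-- The pairing `⟨z,w⟩ = ∑_j z_j conj (w_j)`. -/
def herm {n : ℕ} (z w : En n) : ℂ := ∑ j, z j * (starRingEnd ℂ) (w j)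

/-- The Carleson tent `S_ζ`. -/
def tent {n : ℕ} (ζ : En n) : Set (En n) :=
  {z ∈ ball (0 : En n) 1 | 1 / 2 < (1 - ‖ζ‖) / ‖1 - herm z ζ‖}

/-- The measure `λ_n` on `B_n`, `dλ_n(z) = (1-|z|²)^{-n-1} dV(z)`. -/
def lambdaM (n : ℕ) : Measure (En n) :=
  ((volume : Measure (En n)).restrict (ball (0 : En n) 1)).withDensity
    fun z => ENNReal.ofReal ((1 - ‖z‖ ^ 2) ^ (-(n : ℝ) - 1))

/-- The normalized rotation-invariant surface measure `σ` on the unit sphere `∂B_n`. -/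
def sphereM (n : ℕ) : Measure (sphere (0 : En n) 1) :=
  (((volume : Measure (En n)).toSphere) Set.univ)⁻¹ • ((volume : Measure (En n)).toSphere)

/-- The squared Hilbert–Schmidt norm of the holomorphic derivative `f′(z) = (∂f_i/∂z_j)`. -/
def hsSq {n : ℕ} (f : En n → l2) (z : En n) : ℝ :=
  ∑' i : ℕ, ∑ j, ‖(fderiv ℂ f z (EuclideanSpace.single j 1)) i‖ ^ 2

/-- The squared Carleson-measure norm `‖g‖_CM²` of a scalar function on the ball. -/
def cmSq {n : ℕ} (g : En n → ℝ) : ℝ≥0∞ :=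
  ⨆ (ζ : En n) (_ : ζ ∈ ball (0 : En n) 1 \ {0}),
    (ENNReal.ofReal ((1 - ‖ζ‖) ^ n))⁻¹ *
      ∫⁻ z in tent ζ, ENNReal.ofReal ((g z) ^ 2) ∂(lambdaM n)

/-- The radial derivative `Rf(z) = ∑_j z_j ∂f/∂z_j(z)` of `f : B_n → ℓ²`. -/
def radD {n : ℕ} (f : En n → l2) (z : En n) : l2 :=
  ∑ j, z j • fderiv ℂ f z (EuclideanSpace.single j 1)

/-- The `H¹(B_n; ℓ²)` norm `sup_{0<r<1} ∫_{∂B_n} ‖f(rζ)‖ dσ(ζ)`. -/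
def h1Ball {n : ℕ} (f : En n → l2) : ℝ≥0∞ :=
  ⨆ (r : ℝ) (_ : r ∈ Ioo (0 : ℝ) 1),
    ∫⁻ ζ : sphere (0 : En n) 1, ENNReal.ofReal ‖f (r • (ζ : En n))‖ ∂(sphereM n)

open scoped Pointwise
set_option linter.unusedSectionVars false
section slice
variable {H : Type*} [NormedAddCommGroup H] [InnerProductSpace ℂ H]


def rin (x y : H) : ℝ := (inner ℂ x y : ℂ).re

def uu (ε : ℝ) (x : H) : ℝ := Real.sqrt (‖x‖ ^ 2 + ε ^ 2)

lemma uu_pos {ε : ℝ} (hε : 0 < ε) (x : H) : 0 < uu ε x := by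
  unfold uu; positivity

lemma uu_sq (ε : ℝ) (x : H) : uu ε x ^ 2 = ‖x‖ ^ 2 + ε ^ 2 := by
  unfold uu; rw [Real.sq_sqrt]; positivity

lemma norm_le_uu (ε : ℝ) (x : H) : ‖x‖ ≤ uu ε x := by
  unfold uu; apply Real.le_sqrt_of_sq_le; nlinarith [sq_nonneg ε]

lemma uu_le {ε : ℝ} (hε : 0 < ε) (x : H) : uu ε x ≤ ‖x‖ + ε := by
  unfold uu; apply Real.sqrt_le_iff.2
  constructor
  · positivity
  · nlinarith [norm_nonneg x, mul_nonneg (norm_nonneg x) hε.le]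

lemma rin_abs_le (x y : H) : |rin x y| ≤ ‖x‖ * ‖y‖ :=
  (Complex.abs_re_le_norm _).trans (norm_inner_le_norm x y)

lemma hasDerivAt_rin {g h : ℝ → H} {g' h' : H} {t : ℝ} (hg : HasDerivAt g g' t)
    (hh : HasDerivAt h h' t) :
    HasDerivAt (fun s => rin (g s) (h s)) (rin (g t) h' + rin g' (h t)) t := by
  have h1 := HasDerivAt.inner ℂ hg hh
  have h2 := (Complex.reCLM.hasFDerivAt (x := inner ℂ (g t) (h t))).comp_hasDerivAt t h1
  simpa [rin, Function.comp_def] using h2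

lemma rin_self (x : H) : rin x x = ‖x‖ ^ 2 := by
  have := inner_self_eq_norm_sq (𝕜 := ℂ) x
  simpa [rin] using this

lemma rin_comm (x y : H) : rin x y = rin y x := by
  have := inner_re_symm (𝕜 := ℂ) x y
  simpa [rin] using this

lemma hasDerivAt_uu {ε : ℝ} (hε : 0 < ε) {g : ℝ → H} {g' : H} {t : ℝ} (hg : HasDerivAt g g' t) :
    HasDerivAt (fun s => uu ε (g s)) (rin (g t) g' / uu ε (g t)) t := by
  have h1 : HasDerivAt (fun s => ‖g s‖ ^ 2 + ε ^ 2) (rin (g t) g' + rin g' (g t)) t := by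
    have := (hasDerivAt_rin hg hg).add_const (ε ^ 2)
    simpa only [rin_self] using this
  have h2 := h1.sqrt (by positivity)
  refine h2.congr_deriv ?_
  rw [rin_comm g']
  simp only [uu]
  have : Real.sqrt (‖g t‖ ^ 2 + ε ^ 2) ≠ 0 := by positivity
  field_simp
  ring

lemma hasDerivAt_uu2 {ε : ℝ} (hε : 0 < ε) {g g1 : ℝ → H} {g2 : H} {t : ℝ}
    (hg : HasDerivAt g (g1 t) t) (hg1 : HasDerivAt g1 g2 t) :
    HasDerivAt (fun s => rin (g s) (g1 s) / uu ε (g s))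
      ((‖g1 t‖ ^ 2 + rin (g t) g2) / uu ε (g t) - rin (g t) (g1 t) ^ 2 / uu ε (g t) ^ 3) t := by
  have h := (hasDerivAt_rin hg hg1).div (hasDerivAt_uu hε hg) (uu_pos hε (g t)).ne'
  refine h.congr_deriv ?_
  have := (uu_pos hε (g t)).ne'
  rw [rin_self]
  field_simp
  ring

lemma continuous_uu (ε : ℝ) : Continuous (uu ε : H → ℝ) := by
  unfold uu; fun_prop

lemma continuous_rin : Continuous (fun p : H × H => rin p.1 p.2) := by
  unfold rin; fun_prop

lemma key_ineq {ε : ℝ} (hε : 0 < ε) (g g1 g2 : H) :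
    ‖g1‖ ^ 2 / uu ε g ≤
      ((‖g1‖ ^ 2 + rin g g2) / uu ε g - rin g g1 ^ 2 / uu ε g ^ 3) +
      ((‖I • g1‖ ^ 2 + rin g (-g2)) / uu ε g - rin g (I • g1) ^ 2 / uu ε g ^ 3) := by
  have hu := uu_pos hε g
  have h1 : rin g g1 ^ 2 + rin g (I • g1) ^ 2 ≤ ‖g‖ ^ 2 * ‖g1‖ ^ 2 := by
    have e : rin g g1 ^ 2 + rin g (I • g1) ^ 2 = ‖(inner ℂ g g1 : ℂ)‖ ^ 2 := by
      rw [Complex.sq_norm, Complex.normSq_apply]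
      simp only [rin, inner_smul_right]
      simp
      ring
    rw [e, ← mul_pow]
    gcongr
    exact norm_inner_le_norm g g1
  have h2 : rin g (-g2) = - rin g g2 := by simp [rin]
  have h3 : ‖I • g1‖ = ‖g1‖ := by simp [norm_smul]
  rw [h2, h3]
  have h4 : (rin g g1 ^ 2 + rin g (I • g1) ^ 2) / uu ε g ^ 3 ≤ ‖g1‖ ^ 2 / uu ε g := by
    rw [div_le_div_iff₀ (by positivity) hu]
    have : ‖g‖ ^ 2 ≤ uu ε g ^ 2 := by rw [uu_sq]; nlinarith [sq_nonneg ε]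
    calc _ ≤ ‖g‖ ^ 2 * ‖g1‖ ^ 2 * uu ε g := by gcongr
      _ ≤ uu ε g ^ 2 * ‖g1‖ ^ 2 * uu ε g := by gcongr
      _ = _ := by ring
  have h5 : ((‖g1‖ ^ 2 + rin g g2) / uu ε g - rin g g1 ^ 2 / uu ε g ^ 3) +
      ((‖g1‖ ^ 2 + - rin g g2) / uu ε g - rin g (I • g1) ^ 2 / uu ε g ^ 3)
      = 2 * (‖g1‖ ^ 2 / uu ε g) - (rin g g1 ^ 2 + rin g (I • g1) ^ 2) / uu ε g ^ 3 := by
    ring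
  rw [h5]; linarith
end slice

section slice2
variable {H : Type*} [NormedAddCommGroup H] [InnerProductSpace ℂ H] [CompleteSpace H]

def utt (ε : ℝ) (g g1 g2 : H) : ℝ :=
  (‖g1‖ ^ 2 + rin g g2) / uu ε g - rin g g1 ^ 2 / uu ε g ^ 3

def wpt (t θ : ℝ) : ℂ := (t : ℂ) + (θ : ℂ) * I

lemma wpt_re (t θ : ℝ) : (wpt t θ).re = t := by simp [wpt]

lemma continuous_wpt : Continuous (fun p : ℝ × ℝ => wpt p.1 p.2) := by
  unfold wpt; fun_prop

lemma hasDerivAt_t {G : ℂ → H} {G' : H} {t θ : ℝ} (h : HasDerivAt G G' (wpt t θ)) :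
    HasDerivAt (fun s => G (wpt s θ)) G' t := by
  have h1 : HasDerivAt (fun s : ℝ => wpt s θ) 1 t := by
    unfold wpt; exact (Complex.ofRealCLM.hasDerivAt (x := t)).add_const _
  have := HasDerivAt.scomp (𝕜 := ℝ) t h h1
  simpa [Function.comp_def] using this

lemma hasDerivAt_th {G : ℂ → H} {G' : H} {t θ : ℝ} (h : HasDerivAt G G' (wpt t θ)) :
    HasDerivAt (fun s => G (wpt t s)) (I • G') θ := by
  have h1 : HasDerivAt (fun s : ℝ => wpt t s) I θ := by
    unfold wpt
    simpa using ((Complex.ofRealCLM.hasDerivAt (x := θ)).mul_const I).const_add (t : ℂ)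
  have := HasDerivAt.scomp (𝕜 := ℝ) θ h h1
  simpa [Function.comp_def] using this

lemma continuousOn_utt {X : Type*} [TopologicalSpace X] {s : Set X} {ε : ℝ} (hε : 0 < ε)
    {g g1 g2 : X → H} (h : ContinuousOn g s) (h1 : ContinuousOn g1 s) (h2 : ContinuousOn g2 s) :
    ContinuousOn (fun x => utt ε (g x) (g1 x) (g2 x)) s := by
  have hu : ContinuousOn (fun x => uu ε (g x)) s := (continuous_uu ε).comp_continuousOn h
  have c2 : ContinuousOn (fun x => rin (g x) (g2 x)) s :=
    (continuous_rin).comp_continuousOn (h.prodMk h2)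
  have c1 : ContinuousOn (fun x => rin (g x) (g1 x)) s :=
    (continuous_rin).comp_continuousOn (h.prodMk h1)
  unfold utt
  refine ContinuousOn.sub (ContinuousOn.div (by fun_prop) hu fun x _ => (uu_pos hε _).ne')
    (ContinuousOn.div (by fun_prop) (by fun_prop) fun x _ => pow_ne_zero _ (ne_of_gt (uu_pos hε _)))

/-- Fubini for continuous functions on a rectangle. -/
lemma rect_swap {F : ℝ × ℝ → ℝ} {a T b : ℝ} (haT : a ≤ T) (hb : 0 ≤ b)
    (hF : ContinuousOn F (Icc a T ×ˢ Icc 0 b)) :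
    ∫ t in a..T, ∫ θ in (0:ℝ)..b, F (t, θ) = ∫ θ in (0:ℝ)..b, ∫ t in a..T, F (t, θ) := by
  have hi : IntegrableOn F (Icc a T ×ˢ Icc 0 b) :=
    hF.integrableOn_compact (isCompact_Icc.prod isCompact_Icc)
  have hi2 : IntegrableOn F (Ioc a T ×ˢ Ioc 0 b) :=
    hi.mono_set (prod_mono Ioc_subset_Icc_self Ioc_subset_Icc_self)
  simp only [intervalIntegral.integral_of_le haT, intervalIntegral.integral_of_le hb]
  apply integral_integral_swap (f := fun t θ => F (t, θ))
  rw [Measure.prod_restrict]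
  exact hi2

lemma slice_real {G : ℂ → H} (hG : DifferentiableOn ℂ G {w | w.re < 0})
    (hper : ∀ w, G (w + 2 * Real.pi * I) = G w) {a T ε D : ℝ} (haT : a < T) (hT : T < 0)
    (hε : 0 < ε) (hD : ∀ θ : ℝ, ‖deriv G (wpt a θ)‖ ≤ D) :
    ∫ θ in (0:ℝ)..(2 * Real.pi), ∫ t in a..T, (T - t) *
        (utt ε (G (wpt t θ)) (deriv G (wpt t θ)) (deriv (deriv G) (wpt t θ)) +
         utt ε (G (wpt t θ)) (I • deriv G (wpt t θ)) (-deriv (deriv G) (wpt t θ))) ≤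
      ∫ θ in (0:ℝ)..(2 * Real.pi), (‖G (wpt T θ)‖ + ε + (T - a) * D) := by
  have ho : IsOpen {w : ℂ | w.re < 0} := isOpen_lt continuous_re continuous_const
  have hG1 : DifferentiableOn ℂ (deriv G) {w | w.re < 0} := hG.deriv ho
  have hG2 : DifferentiableOn ℂ (deriv (deriv G)) {w | w.re < 0} := hG1.deriv ho
  have d0 : ∀ w : ℂ, w.re < 0 → HasDerivAt G (deriv G w) w := fun w hw =>
    (hG.differentiableAt (ho.mem_nhds hw)).hasDerivAt
  have d1 : ∀ w : ℂ, w.re < 0 → HasDerivAt (deriv G) (deriv (deriv G) w) w := fun w hw =>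
    (hG1.differentiableAt (ho.mem_nhds hw)).hasDerivAt
  have hper1 : ∀ w, deriv G (w + 2 * Real.pi * I) = deriv G w := by
    intro w
    rw [← deriv_comp_add_const]
    congr 1
    ext z; exact hper z
  have hpi : (0:ℝ) ≤ 2 * Real.pi := by positivity
  have cw : ∀ s : Set (ℝ × ℝ), ContinuousOn (fun p : ℝ × ℝ => wpt p.1 p.2) s :=
    fun s => continuous_wpt.continuousOn
  set S : Set (ℝ × ℝ) := {p | p.1 < 0} with hS
  have mS : MapsTo (fun p : ℝ × ℝ => wpt p.1 p.2) S {w | w.re < 0} := by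
    intro p hp
    change (wpt p.1 p.2).re < 0
    rw [wpt_re]; exact hp
  have c0 : ContinuousOn (fun p : ℝ × ℝ => G (wpt p.1 p.2)) S :=
    hG.continuousOn.comp (cw S) mS
  have c1 : ContinuousOn (fun p : ℝ × ℝ => deriv G (wpt p.1 p.2)) S :=
    hG1.continuousOn.comp (cw S) mS
  have c2 : ContinuousOn (fun p : ℝ × ℝ => deriv (deriv G) (wpt p.1 p.2)) S :=
    hG2.continuousOn.comp (cw S) mS
  set A : ℝ × ℝ → ℝ := fun p => (T - p.1) *
    utt ε (G (wpt p.1 p.2)) (deriv G (wpt p.1 p.2)) (deriv (deriv G) (wpt p.1 p.2)) with hA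
  set B : ℝ × ℝ → ℝ := fun p => (T - p.1) *
    utt ε (G (wpt p.1 p.2)) (I • deriv G (wpt p.1 p.2)) (-deriv (deriv G) (wpt p.1 p.2)) with hB
  have cA : ContinuousOn A S := (by fun_prop : ContinuousOn (fun p : ℝ × ℝ => T - p.1) S).mul
    (continuousOn_utt hε c0 c1 c2)
  have cB : ContinuousOn B S := (by fun_prop : ContinuousOn (fun p : ℝ × ℝ => T - p.1) S).mul
    (continuousOn_utt hε c0 (c1.const_smul I) c2.neg)
  have sub : Icc a T ×ˢ Icc 0 (2 * Real.pi) ⊆ S := fun p hp => lt_of_le_of_lt hp.1.2 hT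
  -- sections in t
  have secT : ∀ (F : ℝ × ℝ → ℝ), ContinuousOn F S → ∀ θ : ℝ,
      IntervalIntegrable (fun t => F (t, θ)) volume a T := by
    intro F hF θ
    apply ContinuousOn.intervalIntegrable
    rw [uIcc_of_le haT.le]
    exact hF.comp (by fun_prop) fun t ht => lt_of_le_of_lt ht.2 hT
  have secTh : ∀ (F : ℝ × ℝ → ℝ), ContinuousOn F S → ∀ t : ℝ, t < 0 →
      Continuous (fun θ => F (t, θ)) := by
    intro F hF t ht
    exact hF.comp_continuous (by fun_prop) fun θ => ht
  -- integrated in t, continuous in θ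
  have intc : ∀ (F : ℝ × ℝ → ℝ), ContinuousOn F S →
      IntervalIntegrable (fun θ => ∫ t in a..T, F (t, θ)) volume 0 (2 * Real.pi) := by
    intro F hF
    rw [intervalIntegrable_iff_integrableOn_Ioc_of_le hpi]
    have hi : IntegrableOn F (Ioc a T ×ˢ Ioc 0 (2 * Real.pi)) :=
      ((hF.mono sub).integrableOn_compact (isCompact_Icc.prod isCompact_Icc)).mono_set
        (prod_mono Ioc_subset_Icc_self Ioc_subset_Icc_self)
    unfold IntegrableOn at hi ⊢
    rw [Measure.volume_eq_prod, ← Measure.prod_restrict] at hi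
    simp only [intervalIntegral.integral_of_le haT.le]
    exact hi.integral_prod_right
  -- B integrates to zero
  have zB : ∫ θ in (0:ℝ)..(2 * Real.pi), ∫ t in a..T, B (t, θ) = 0 := by
    rw [← rect_swap haT.le hpi (cB.mono sub)]
    rw [intervalIntegral.integral_congr (g := fun _ => (0:ℝ)), intervalIntegral.integral_zero]
    intro t ht
    rw [uIcc_of_le haT.le] at ht
    have ht0 : t < 0 := lt_of_le_of_lt ht.2 hT
    simp only [hB]
    rw [intervalIntegral.integral_const_mul]
    rw [intervalIntegral.integral_eq_sub_of_hasDerivAt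
      (f := fun θ => rin (G (wpt t θ)) (I • deriv G (wpt t θ)) / uu ε (G (wpt t θ)))]
    · have e : wpt t (2 * Real.pi) = wpt t 0 + 2 * Real.pi * I := by simp [wpt]
      rw [e, hper, hper1]; simp
    · intro θ _
      have hw : (wpt t θ).re < 0 := by rwa [wpt_re]
      have q1 := hasDerivAt_th (d0 _ hw)
      have q2 := (hasDerivAt_th (d1 _ hw)).const_smul I
      have := hasDerivAt_uu2 hε (g1 := fun θ => I • deriv G (wpt t θ)) q1 q2
      refine this.congr_deriv ?_
      simp only [utt]
      rw [smul_smul, I_mul_I, neg_one_smul]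
    · have : ContinuousOn (fun p : ℝ × ℝ => utt ε (G (wpt p.1 p.2)) (I • deriv G (wpt p.1 p.2))
        (-deriv (deriv G) (wpt p.1 p.2))) S := continuousOn_utt hε c0 (c1.const_smul I) c2.neg
      exact (secTh _ this t ht0).intervalIntegrable _ _
  -- Taylor for A
  have tA : ∀ θ : ℝ, ∫ t in a..T, A (t, θ) = uu ε (G (wpt T θ)) - (uu ε (G (wpt a θ)) +
      (T - a) * (rin (G (wpt a θ)) (deriv G (wpt a θ)) / uu ε (G (wpt a θ)))) := by
    intro θ
    rw [intervalIntegral.integral_eq_sub_of_hasDerivAt (f := fun t => uu ε (G (wpt t θ)) +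
      (T - t) * (rin (G (wpt t θ)) (deriv G (wpt t θ)) / uu ε (G (wpt t θ))))]
    · simp
    · intro t ht
      rw [uIcc_of_le haT.le] at ht
      have hw : (wpt t θ).re < 0 := by rw [wpt_re]; exact lt_of_le_of_lt ht.2 hT
      have q1 := hasDerivAt_t (d0 _ hw)
      have q2 := hasDerivAt_t (d1 _ hw)
      have r1 := hasDerivAt_uu hε q1
      have r2 := hasDerivAt_uu2 hε (g1 := fun t => deriv G (wpt t θ)) q1 q2
      have r3 := r1.add (((hasDerivAt_id t).const_sub T).mul r2)
      refine r3.congr_deriv ?_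
      simp only [hA, utt, id]
      ring
    · exact secT A cA θ
  have bA : ∀ θ : ℝ, ∫ t in a..T, A (t, θ) ≤ ‖G (wpt T θ)‖ + ε + (T - a) * D := by
    intro θ
    rw [tA]
    have h1 := uu_le hε (G (wpt T θ))
    have hu := uu_pos hε (G (wpt a θ))
    have h2 : -D ≤ rin (G (wpt a θ)) (deriv G (wpt a θ)) / uu ε (G (wpt a θ)) := by
      rw [le_div_iff₀ hu]
      have := (abs_le.1 (rin_abs_le (G (wpt a θ)) (deriv G (wpt a θ)))).1
      have : ‖G (wpt a θ)‖ * ‖deriv G (wpt a θ)‖ ≤ uu ε (G (wpt a θ)) * D := by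
        gcongr
        · exact norm_le_uu _ _
        · exact hD θ
      linarith
    have h3 : (T - a) * (-D) ≤ (T - a) * (rin (G (wpt a θ)) (deriv G (wpt a θ)) /
        uu ε (G (wpt a θ))) := mul_le_mul_of_nonneg_left h2 (by linarith)
    linarith
  calc _ = ∫ θ in (0:ℝ)..(2 * Real.pi), ((∫ t in a..T, A (t, θ)) + ∫ t in a..T, B (t, θ)) := by
        apply intervalIntegral.integral_congr
        intro θ _
        simp only
        rw [← intervalIntegral.integral_add (secT A cA θ) (secT B cB θ)]
        simp only [hA, hB, mul_add]
    _ = ∫ θ in (0:ℝ)..(2 * Real.pi), ∫ t in a..T, A (t, θ) := by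
        rw [intervalIntegral.integral_add (intc A cA) (intc B cB), zB, add_zero]
    _ ≤ _ := by
        apply intervalIntegral.integral_mono_on hpi (intc A cA) _ fun θ _ => bA θ
        apply Continuous.intervalIntegrable
        have : Continuous (fun θ : ℝ => G (wpt T θ)) := (c0.comp_continuous (f := fun θ : ℝ => (T, θ)) (by fun_prop) fun θ => hT)
        exact (this.norm.add_const _).add_const _
end slice2

section slice3
variable {H : Type*} [NormedAddCommGroup H] [InnerProductSpace ℂ H] [CompleteSpace H]

lemma slice_lint {G : ℂ → H} (hG : DifferentiableOn ℂ G {w | w.re < 0})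
    (hper : ∀ w, G (w + 2 * Real.pi * I) = G w) {a T ε D : ℝ} (haT : a < T) (hT : T < 0)
    (hε : 0 < ε) (hD : ∀ θ : ℝ, ‖deriv G (wpt a θ)‖ ≤ D) :
    ∫⁻ θ in Ioc (0:ℝ) (2 * Real.pi), ∫⁻ t in Ioc a T,
        ENNReal.ofReal ((T - t) * (‖deriv G (wpt t θ)‖ ^ 2 / uu ε (G (wpt t θ)))) ≤
      (∫⁻ θ in Ioc (0:ℝ) (2 * Real.pi), ENNReal.ofReal ‖G (wpt T θ)‖) +
        ENNReal.ofReal (2 * Real.pi * (ε + (T - a) * D)) := by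
  have ho : IsOpen {w : ℂ | w.re < 0} := isOpen_lt continuous_re continuous_const
  have hG1 : DifferentiableOn ℂ (deriv G) {w | w.re < 0} := hG.deriv ho
  have hG2 : DifferentiableOn ℂ (deriv (deriv G)) {w | w.re < 0} := hG1.deriv ho
  have hpi : (0:ℝ) ≤ 2 * Real.pi := by positivity
  have hD0 : 0 ≤ D := (norm_nonneg _).trans (hD 0)
  have cw : ∀ s : Set (ℝ × ℝ), ContinuousOn (fun p : ℝ × ℝ => wpt p.1 p.2) s :=
    fun s => continuous_wpt.continuousOn
  set S : Set (ℝ × ℝ) := {p | p.1 < 0} with hS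
  have mS : MapsTo (fun p : ℝ × ℝ => wpt p.1 p.2) S {w | w.re < 0} := by
    intro p hp
    change (wpt p.1 p.2).re < 0
    rw [wpt_re]; exact hp
  have c0 : ContinuousOn (fun p : ℝ × ℝ => G (wpt p.1 p.2)) S :=
    hG.continuousOn.comp (cw S) mS
  have c1 : ContinuousOn (fun p : ℝ × ℝ => deriv G (wpt p.1 p.2)) S :=
    hG1.continuousOn.comp (cw S) mS
  have c2 : ContinuousOn (fun p : ℝ × ℝ => deriv (deriv G) (wpt p.1 p.2)) S :=
    hG2.continuousOn.comp (cw S) mS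
  set F : ℝ × ℝ → ℝ := fun p => (T - p.1) *
    (utt ε (G (wpt p.1 p.2)) (deriv G (wpt p.1 p.2)) (deriv (deriv G) (wpt p.1 p.2)) +
    utt ε (G (wpt p.1 p.2)) (I • deriv G (wpt p.1 p.2)) (-deriv (deriv G) (wpt p.1 p.2))) with hF
  have cF : ContinuousOn F S := (by fun_prop : ContinuousOn (fun p : ℝ × ℝ => T - p.1) S).mul
    ((continuousOn_utt hε c0 c1 c2).add (continuousOn_utt hε c0 (c1.const_smul I) c2.neg))
  have sub : Icc a T ×ˢ Icc 0 (2 * Real.pi) ⊆ S := fun p hp => lt_of_le_of_lt hp.1.2 hT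
  have hi : IntegrableOn F (Ioc a T ×ˢ Ioc 0 (2 * Real.pi)) :=
      ((cF.mono sub).integrableOn_compact (isCompact_Icc.prod isCompact_Icc)).mono_set
        (prod_mono Ioc_subset_Icc_self Ioc_subset_Icc_self)
  unfold IntegrableOn at hi
  rw [Measure.volume_eq_prod, ← Measure.prod_restrict] at hi
  have hi2 := hi.integral_prod_right
  have le : ∀ t θ, t ≤ T → (T - t) * (‖deriv G (wpt t θ)‖ ^ 2 / uu ε (G (wpt t θ))) ≤ F (t, θ) := by
    intro t θ ht
    exact mul_le_mul_of_nonneg_left (key_ineq hε _ _ _) (by linarith)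
  have F0 : ∀ t θ, t ≤ T → 0 ≤ F (t, θ) := by
    intro t θ ht
    refine le_trans ?_ (le t θ ht)
    exact mul_nonneg (by linarith) (div_nonneg (by positivity) (uu_pos hε _).le)
  have secT : ∀ θ : ℝ, IntegrableOn (fun t => F (t, θ)) (Ioc a T) := by
    intro θ
    refine IntegrableOn.mono_set ?_ Ioc_subset_Icc_self
    apply ContinuousOn.integrableOn_compact isCompact_Icc
    exact cF.comp (by fun_prop) fun t ht => lt_of_le_of_lt ht.2 hT
  have cT : Continuous (fun θ : ℝ => G (wpt T θ)) :=
    c0.comp_continuous (f := fun θ : ℝ => (T, θ)) (by fun_prop) fun θ => hT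
  have main := slice_real hG hper haT hT hε hD
  rw [intervalIntegral.integral_of_le hpi, intervalIntegral.integral_of_le hpi] at main
  simp only [intervalIntegral.integral_of_le haT.le] at main
  calc _ ≤ ∫⁻ θ in Ioc (0:ℝ) (2 * Real.pi), ENNReal.ofReal (∫ t in Ioc a T, F (t, θ)) := by
        apply lintegral_mono
        intro θ
        simp only
        rw [ofReal_integral_eq_lintegral_ofReal (secT θ)]
        · apply setLIntegral_mono' measurableSet_Ioc
          intro t ht
          exact ENNReal.ofReal_le_ofReal (le t θ ht.2)
        · exact (ae_restrict_iff' measurableSet_Ioc).2 (.of_forall fun t ht => F0 t θ ht.2)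
    _ = ENNReal.ofReal (∫ θ in Ioc (0:ℝ) (2 * Real.pi), ∫ t in Ioc a T, F (t, θ)) := by
        rw [ofReal_integral_eq_lintegral_ofReal hi2]
        refine .of_forall fun θ => ?_
        exact setIntegral_nonneg measurableSet_Ioc fun t ht => F0 t θ ht.2
    _ ≤ ENNReal.ofReal (∫ θ in Ioc (0:ℝ) (2 * Real.pi), (‖G (wpt T θ)‖ + ε + (T - a) * D)) :=
        ENNReal.ofReal_le_ofReal main
    _ = ∫⁻ θ in Ioc (0:ℝ) (2 * Real.pi), ENNReal.ofReal (‖G (wpt T θ)‖ + ε + (T - a) * D) := by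
        rw [ofReal_integral_eq_lintegral_ofReal]
        · exact (Continuous.integrableOn_Ioc ((cT.norm.add_const _).add_const _))
        · exact .of_forall fun θ => by
            have : 0 ≤ (T - a) * D := mul_nonneg (by linarith) hD0
            simp only [Pi.zero_apply]; positivity
    _ = _ := by
        have h0 : 0 ≤ ε + (T - a) * D := by
          have : 0 ≤ (T - a) * D := mul_nonneg (by linarith) hD0
          positivity
        simp_rw [add_assoc, ENNReal.ofReal_add (norm_nonneg _) h0]
        rw [lintegral_add_right _ measurable_const, setLIntegral_const, Real.volume_Ioc, sub_zero,
          ENNReal.ofReal_mul hpi, mul_comm (ENNReal.ofReal (ε + _))]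
end slice3


lemma real_smul_En {n : ℕ} (r : ℝ) (z : En n) : r • z = (r : ℂ) • z := by
  ext i; simp

lemma radD_eq {n : ℕ} (f : En n → l2) (z : En n) : radD f z = fderiv ℂ f z z := by
  have e : z = ∑ j, z j • EuclideanSpace.single j (1 : ℂ) := by
    have := (EuclideanSpace.basisFun (Fin n) ℂ).sum_repr z
    simpa using this.symm
  have key : ∀ L : En n →L[ℂ] l2, ∑ j, z j • L (EuclideanSpace.single j (1 : ℂ)) = L z := by
    intro L
    conv_rhs => rw [e]
    simp only [map_sum, map_smul]
  exact key _

def rotLI {n : ℕ} (c : ℂ) (hc : ‖c‖ = 1) : En n →ₗᵢ[ℝ] En n where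
  toFun z := c • z
  map_add' x y := smul_add c x y
  map_smul' r x := by simp only [real_smul_En, RingHom.id_apply]; rw [smul_comm]
  norm_map' x := by change ‖c • x‖ = ‖x‖; rw [norm_smul, hc, one_mul]

lemma vol_rot {n : ℕ} (c : ℂ) (hc : ‖c‖ = 1) (s : Set (En n)) :
    (volume : Measure (En n)) ((fun z => c • z) ⁻¹' s) = volume s := by
  have h := ((rotLI (n := n) c hc).toLinearIsometryEquiv rfl).measurePreserving
  have := h.measure_preimage_equiv (f := ((rotLI (n := n) c hc).toLinearIsometryEquiv rfl).toMeasurableEquiv) s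
  exact this

lemma lint_rot {n : ℕ} (c : ℂ) (hc : ‖c‖ = 1) {h : En n → ℝ≥0∞} (hh : Measurable h) :
    ∫⁻ ζ : sphere (0 : En n) 1, h (c • (ζ : En n)) ∂(volume : Measure (En n)).toSphere =
      ∫⁻ ζ : sphere (0 : En n) 1, h (ζ : En n) ∂(volume : Measure (En n)).toSphere := by
  let R : sphere (0 : En n) 1 → sphere (0 : En n) 1 := fun ζ =>
    ⟨c • (ζ : En n), by simp [norm_smul, hc]⟩
  have hR : Measurable R := by
    apply Measurable.subtype_mk
    exact (continuous_const_smul c).measurable.comp measurable_subtype_coe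
  have hmap : Measure.map R (volume : Measure (En n)).toSphere = (volume : Measure (En n)).toSphere := by
    ext s hs
    rw [Measure.map_apply hR hs, Measure.toSphere_apply' _ (hR hs), Measure.toSphere_apply' _ hs]
    congr 1
    rw [← vol_rot c hc (Ioo (0:ℝ) 1 • (Set.image Subtype.val s : Set (En n)))]
    congr 1
    have hc0 : c ≠ 0 := by intro h0; simp [h0] at hc
    ext z
    simp only [mem_smul, mem_preimage, mem_image]
    constructor
    · rintro ⟨r, hr, _, ⟨ζ, hζ, rfl⟩, rfl⟩
      refine ⟨r, hr, _, ⟨R ζ, hζ, rfl⟩, ?_⟩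
      simp only [R, real_smul_En]; rw [smul_comm]
    · rintro ⟨r, hr, _, ⟨ζ, hζ, rfl⟩, hz⟩
      have hn : ‖c⁻¹ • (ζ : En n)‖ = 1 := by simp [norm_smul, hc]
      refine ⟨r, hr, _, ⟨⟨c⁻¹ • (ζ : En n), by simpa using hn⟩, ?_, rfl⟩, ?_⟩
      · have : R ⟨c⁻¹ • (ζ : En n), by simpa using hn⟩ = ζ := by
          apply Subtype.ext; simp [R, smul_smul, hc0]
        rw [this]; exact hζ
      · simp only
        rw [real_smul_En, smul_comm, ← real_smul_En, hz, smul_smul, inv_mul_cancel₀ hc0, one_smul]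
  conv_rhs => rw [← hmap]
  exact (lintegral_map (f := fun ζ : sphere (0 : En n) 1 => h ζ)
    (hh.comp measurable_subtype_coe) hR).symm

lemma polar {n : ℕ} (hn : 1 ≤ n) {h : En n → ℝ≥0∞} (hh : Measurable h) :
    ∫⁻ z, h z = ∫⁻ ζ : sphere (0 : En n) 1, (∫⁻ t : ℝ,
      ENNReal.ofReal (Real.exp (2 * n * t)) * h (Real.exp t • (ζ : En n)))
      ∂(volume : Measure (En n)).toSphere := by
  have : Nonempty (Fin n) := ⟨⟨0, hn⟩⟩
  have hdim : Module.finrank ℝ (En n) = 2 * n := by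
    rw [LinearEquiv.finrank_eq (WithLp.linearEquiv 2 ℝ (Fin n → ℂ)), Module.finrank_pi_fintype]
    simp [Complex.finrank_real_complex, mul_comm]
  have hmp := (volume : Measure (En n)).measurePreserving_homeomorphUnitSphereProd
  calc ∫⁻ z, h z = ∫⁻ z in ({0}ᶜ : Set (En n)), h z := by
        rw [restrict_compl_singleton]
    _ = ∫⁻ z : ({0}ᶜ : Set (En n)), h z ∂((volume : Measure (En n)).comap (↑)) := by
        rw [lintegral_subtype_comap (measurableSet_singleton 0).compl]
    _ = ∫⁻ p, h ((homeomorphUnitSphereProd (En n)).symm p : En n)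
          ∂((volume : Measure (En n)).toSphere.prod
            (Measure.volumeIoiPow (Module.finrank ℝ (En n) - 1))) := by
        rw [← hmp.lintegral_comp]
        · simp
        · exact hh.comp (measurable_subtype_coe.comp (Homeomorph.measurable _))
    _ = ∫⁻ ζ : sphere (0 : En n) 1, ∫⁻ r : Ioi (0:ℝ), h ((r:ℝ) • (ζ : En n))
          ∂(Measure.volumeIoiPow (Module.finrank ℝ (En n) - 1))
          ∂(volume : Measure (En n)).toSphere := by
        rw [lintegral_prod]
        · rfl
        · exact (hh.comp (measurable_subtype_coe.comp (Homeomorph.measurable _))).aemeasurable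
    _ = _ := by
        apply lintegral_congr
        intro ζ
        have hm : Measurable (fun r : ℝ => h (r • (ζ : En n))) := by
          apply hh.comp
          exact (by fun_prop : Continuous (fun r : ℝ => r • (ζ : En n))).measurable
        rw [Measure.volumeIoiPow, lintegral_withDensity_eq_lintegral_mul₀]
        · simp only [Pi.mul_apply]
          rw [lintegral_subtype_comap measurableSet_Ioi
            (fun r : ℝ => ENNReal.ofReal (r ^ (Module.finrank ℝ (En n) - 1)) * h (r • (ζ : En n)))]
          rw [← Real.range_exp, ← image_univ]
          rw [lintegral_image_eq_lintegral_abs_deriv_mul MeasurableSet.univ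
            (fun t _ => (Real.hasDerivAt_exp t).hasDerivWithinAt) Real.exp_injective.injOn]
          rw [Measure.restrict_univ]
          apply lintegral_congr
          intro t
          rw [← mul_assoc, abs_of_pos (Real.exp_pos t), ← ENNReal.ofReal_mul (Real.exp_pos t).le,
            hdim, ← pow_succ', Nat.sub_add_cancel (by omega), ← Real.exp_nat_mul]
          push_cast
          rfl
        · fun_prop
        · exact (hm.comp measurable_subtype_coe).aemeasurable


lemma line_deriv {n : ℕ} {f : En n → l2} (hf : DifferentiableOn ℂ f (ball (0 : En n) 1))
    {z : En n} (hz : z ∈ ball (0 : En n) 1) (v : En n) :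
    HasDerivAt (fun c : ℂ => f (z + c • v)) (fderiv ℂ f z v) 0 := by
  have h1 : HasFDerivAt f (fderiv ℂ f z) (z + (0:ℂ) • v) := by
    simpa using (hf.differentiableAt (isOpen_ball.mem_nhds hz)).hasFDerivAt
  have h2 : HasDerivAt (fun c : ℂ => z + c • v) v 0 := by
    simpa using ((hasDerivAt_id (0:ℂ)).smul_const v).const_add z
  exact h1.comp_hasDerivAt 0 h2

lemma slice_deriv {n : ℕ} {f : En n → l2} (hf : DifferentiableOn ℂ f (ball (0 : En n) 1))
    {ζ : En n} {w : ℂ} (hz : cexp w • ζ ∈ ball (0 : En n) 1) :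
    HasDerivAt (fun w : ℂ => f (cexp w • ζ)) (radD f (cexp w • ζ)) w := by
  rw [radD_eq]
  have h1 : HasFDerivAt f (fderiv ℂ f (cexp w • ζ)) (cexp w • ζ) :=
    (hf.differentiableAt (isOpen_ball.mem_nhds hz)).hasFDerivAt
  have h2 : HasDerivAt (fun w : ℂ => cexp w • ζ) (cexp w • ζ) w :=
    (Complex.hasDerivAt_exp w).smul_const ζ
  exact h1.comp_hasDerivAt w h2

lemma radD_bound {n : ℕ} {f : En n → l2} (hf : DifferentiableOn ℂ f (ball (0 : En n) 1)) :
    ∃ M : ℝ, 0 ≤ M ∧ ∀ z : En n, ‖z‖ ≤ 1 / 2 → ‖radD f z‖ ≤ M * ‖z‖ := by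
  have hsub : closedBall (0 : En n) (3 / 4) ⊆ ball 0 1 := closedBall_subset_ball (by norm_num)
  obtain ⟨K, hK⟩ := (isCompact_closedBall (0 : En n) (3 / 4)).exists_bound_of_continuousOn
    (hf.continuousOn.mono hsub)
  have hK0 : 0 ≤ K := (norm_nonneg _).trans (hK 0 (by rw [mem_closedBall_zero_iff, norm_zero]; norm_num))
  refine ⟨K / (1 / 4), by positivity, fun z hz => ?_⟩
  rw [radD_eq]
  rcases eq_or_ne z 0 with rfl | hz0
  · simp
  have hzn : 0 < ‖z‖ := norm_pos_iff.2 hz0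
  set v : En n := ((‖z‖⁻¹ : ℝ) : ℂ) • z with hv
  have hv1 : ‖v‖ = 1 := by
    rw [hv, norm_smul, Complex.norm_real, norm_inv, norm_norm, inv_mul_cancel₀ hzn.ne']
  have hzv : z = ((‖z‖ : ℝ) : ℂ) • v := by
    rw [hv, smul_smul, ← Complex.ofReal_mul, mul_inv_cancel₀ hzn.ne']; simp
  have mem : ∀ c : ℂ, ‖c‖ ≤ 1 / 4 → z + c • v ∈ closedBall (0 : En n) (3 / 4) := by
    intro c hc
    rw [mem_closedBall_zero_iff]
    refine (norm_add_le _ _).trans ?_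
    rw [norm_smul, hv1]; linarith
  have hball : z ∈ ball (0 : En n) 1 := by rw [mem_ball_zero_iff]; linarith
  have h1 := (line_deriv hf hball v).deriv
  have h2 : ‖deriv (fun c : ℂ => f (z + c • v)) 0‖ ≤ K / (1 / 4) := by
    apply norm_deriv_le_of_forall_mem_sphere_norm_le (by norm_num)
    · apply DifferentiableOn.diffContOnCl
      rw [closure_ball _ (by norm_num)]
      apply hf.comp (by fun_prop)
      intro c hc
      exact hsub (mem c (by simpa using hc))
    · intro c hc
      exact hK _ (mem c (by simpa using (mem_sphere_zero_iff_norm.1 hc).le))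
  rw [h1] at h2
  conv_lhs => rw [show fderiv ℂ f z z = fderiv ℂ f z (((‖z‖ : ℝ) : ℂ) • v) by rw [← hzv]]
  rw [map_smul, norm_smul, Complex.norm_real, norm_norm, mul_comm]
  gcongr

lemma meas_f {n : ℕ} {f : En n → l2} (hf : DifferentiableOn ℂ f (ball (0 : En n) 1)) :
    Measurable ((ball (0 : En n) 1).indicator fun z => ‖f z‖) := by
  classical
  rw [← piecewise_eq_indicator]
  exact ContinuousOn.measurable_piecewise hf.continuousOn.norm continuousOn_const measurableSet_ball

lemma meas_radD {n : ℕ} {f : En n → l2} (hf : DifferentiableOn ℂ f (ball (0 : En n) 1)) :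
    Measurable ((ball (0 : En n) 1).indicator fun z => ‖radD f z‖) := by
  classical
  let c : ℕ → ℂ := fun k => ((-(1 / ((k : ℝ) + 1)) : ℝ) : ℂ)
  have hc0 : ∀ k, c k ≠ 0 := by
    intro k
    have : (k : ℝ) + 1 ≠ 0 := by positivity
    simp only [c, ne_eq, Complex.ofReal_eq_zero, neg_eq_zero]
    positivity
  have hcl : Filter.Tendsto c Filter.atTop (𝓝 0) := by
    have : Filter.Tendsto (fun k : ℕ => -(1 / ((k : ℝ) + 1))) Filter.atTop (𝓝 (-0)) :=
      tendsto_one_div_add_atTop_nhds_zero_nat.neg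
    rw [neg_zero] at this
    exact (Complex.continuous_ofReal.tendsto 0).comp this
  let q : ℕ → En n → ℝ := fun k => (ball (0 : En n) 1).indicator
    fun z => ‖(c k)⁻¹ • (f (z + c k • z) - f z)‖
  have hmaps : ∀ k, MapsTo (fun z : En n => z + c k • z) (ball 0 1) (ball 0 1) := by
    intro k z hz
    rw [mem_ball_zero_iff] at hz ⊢
    have e : z + c k • z = (((1 - 1 / ((k : ℝ) + 1)) : ℝ) : ℂ) • z := by
      simp only [c]; rw [sub_eq_add_neg, Complex.ofReal_add, add_smul]; simp
    change ‖z + c k • z‖ < 1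
    rw [e, norm_smul, Complex.norm_real]
    have h1 : 0 ≤ 1 - 1 / ((k : ℝ) + 1) := by
      rw [sub_nonneg, div_le_one (by positivity)]; linarith [Nat.cast_nonneg (α := ℝ) k]
    have h2 : 1 - 1 / ((k : ℝ) + 1) ≤ 1 := by
      have : 0 ≤ 1 / ((k : ℝ) + 1) := by positivity
      linarith
    rw [Real.norm_of_nonneg h1]
    nlinarith [norm_nonneg z]
  have hq : ∀ k, Measurable (q k) := by
    intro k
    simp only [q]
    rw [← piecewise_eq_indicator]
    refine ContinuousOn.measurable_piecewise ?_ continuousOn_const measurableSet_ball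
    have h1 : ContinuousOn (fun z : En n => f (z + c k • z)) (ball 0 1) :=
      hf.continuousOn.comp (by fun_prop) (hmaps k)
    have h3 : ContinuousOn (fun z : En n => f (z + c k • z) - f z) (ball 0 1) :=
      h1.sub hf.continuousOn
    simp_rw [norm_smul]
    exact continuousOn_const.mul h3.norm
  refine measurable_of_tendsto_metrizable hq ?_
  rw [tendsto_pi_nhds]
  intro z
  by_cases hz : z ∈ ball (0 : En n) 1
  · simp only [q, indicator_of_mem hz]
    rw [radD_eq]
    have h := (line_deriv hf hz z).tendsto_slope_zero
    simp only [zero_add, zero_smul, add_zero] at h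
    have h2 : Filter.Tendsto c Filter.atTop (𝓝[≠] 0) :=
      tendsto_nhdsWithin_iff.2 ⟨hcl, .of_forall hc0⟩
    exact (h.comp h2).norm
  · simp only [q, indicator_of_notMem hz]
    exact tendsto_const_nhds


def NF {n : ℕ} (f : En n → l2) : En n → ℝ := (ball (0 : En n) 1).indicator fun z => ‖f z‖
def NR {n : ℕ} (f : En n → l2) : En n → ℝ := (ball (0 : En n) 1).indicator fun z => ‖radD f z‖
def kap {n : ℕ} (f : En n → l2) (ε : ℝ) (z : En n) : ℝ :=
  NR f z ^ 2 / Real.sqrt (NF f z ^ 2 + ε ^ 2)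
def Phi {n : ℕ} (f : En n → l2) (a T ε : ℝ) : En n → ℝ≥0∞ :=
  {z : En n | Real.log ‖z‖ ∈ Ioc a T}.indicator fun z =>
    ENNReal.ofReal (Real.exp (-(2 * n * Real.log ‖z‖)) * ((T - Real.log ‖z‖) * kap f ε z))

lemma meas_kap {n : ℕ} {f : En n → l2} (hf : DifferentiableOn ℂ f (ball (0 : En n) 1)) (ε : ℝ) :
    Measurable (kap f ε) := by
  have h1 : Measurable (NF f) := meas_f hf
  have h2 : Measurable (NR f) := meas_radD hf
  unfold kap
  fun_prop

lemma meas_Phi {n : ℕ} {f : En n → l2} (hf : DifferentiableOn ℂ f (ball (0 : En n) 1)) (a T ε : ℝ) :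
    Measurable (Phi f a T ε) := by
  have h1 := meas_kap hf ε
  have h2 : Measurable (fun z : En n => Real.log ‖z‖) := Real.measurable_log.comp measurable_norm
  unfold Phi
  apply Measurable.indicator
  · fun_prop
  · exact h2 measurableSet_Ioc

lemma Phi_int {n : ℕ} (hn : 1 ≤ n) {f : En n → l2}
    (hf : DifferentiableOn ℂ f (ball (0 : En n) 1)) (a T ε : ℝ) :
    ∫⁻ z, Phi f a T ε z = ∫⁻ ζ : sphere (0 : En n) 1, (∫⁻ t in Ioc a T,
      ENNReal.ofReal ((T - t) * kap f ε (Real.exp t • (ζ : En n))))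
      ∂(volume : Measure (En n)).toSphere := by
  rw [polar hn (meas_Phi hf a T ε)]
  apply lintegral_congr
  intro ζ
  rw [← lintegral_indicator measurableSet_Ioc]
  apply lintegral_congr
  intro t
  have hl : Real.log ‖Real.exp t • (ζ : En n)‖ = t := by
    rw [norm_smul, Real.norm_of_nonneg (Real.exp_pos t).le]
    simp
  by_cases ht : t ∈ Ioc a T
  · have hm : Real.exp t • (ζ : En n) ∈ {z : En n | Real.log ‖z‖ ∈ Ioc a T} := by
      rw [mem_ofPred_eq, hl]; exact ht
    rw [Phi, indicator_of_mem hm, indicator_of_mem ht, hl, ← ENNReal.ofReal_mul (Real.exp_pos _).le,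
      ← mul_assoc, ← Real.exp_add]
    simp
  · have hm : Real.exp t • (ζ : En n) ∉ {z : En n | Real.log ‖z‖ ∈ Ioc a T} := by
      rw [mem_ofPred_eq, hl]; exact ht
    rw [Phi, indicator_of_notMem hm, indicator_of_notMem ht, mul_zero]

lemma avg_rot {n : ℕ} {h : En n → ℝ≥0∞} (hh : Measurable h) :
    ∫⁻ ζ : sphere (0 : En n) 1, (∫⁻ θ in Ioc (0:ℝ) (2 * Real.pi), h (cexp (θ * I) • (ζ : En n)))
      ∂(volume : Measure (En n)).toSphere =
    ENNReal.ofReal (2 * Real.pi) *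
      ∫⁻ ζ : sphere (0 : En n) 1, h (ζ : En n) ∂(volume : Measure (En n)).toSphere := by
  rw [lintegral_lintegral_swap]
  · rw [lintegral_congr (g := fun _ => ∫⁻ ζ : sphere (0 : En n) 1, h (ζ : En n)
      ∂(volume : Measure (En n)).toSphere)]
    · rw [setLIntegral_const, Real.volume_Ioc, sub_zero, mul_comm]
    · intro θ
      exact lint_rot _ (Complex.norm_exp_ofReal_mul_I θ) hh
  · apply Measurable.aemeasurable
    apply hh.comp
    apply Continuous.measurable
    fun_prop

lemma slice_app {n : ℕ} {f : En n → l2}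
    (hf : DifferentiableOn ℂ f (ball (0 : En n) 1)) {M : ℝ}
    (hM : ∀ z : En n, ‖z‖ ≤ 1 / 2 → ‖radD f z‖ ≤ M * ‖z‖) {a T ε : ℝ}
    (ha : a ≤ -1) (haT : a < T) (hT : T < 0) (hε : 0 < ε) {ζ : En n} (hζ : ‖ζ‖ = 1) :
    ∫⁻ θ in Ioc (0:ℝ) (2 * Real.pi), (∫⁻ t in Ioc a T,
      ENNReal.ofReal ((T - t) * kap f ε (Real.exp t • (cexp (θ * I) • ζ)))) ≤
      (∫⁻ θ in Ioc (0:ℝ) (2 * Real.pi),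
        ENNReal.ofReal (NF f (Real.exp T • (cexp (θ * I) • ζ)))) +
        ENNReal.ofReal (2 * Real.pi * (ε + (T - a) * (M * Real.exp a))) := by
  have nrm : ∀ w : ℂ, ‖cexp w • ζ‖ = Real.exp w.re := by
    intro w; rw [norm_smul, hζ, mul_one, Complex.norm_exp]
  have mem : ∀ w : ℂ, w.re < 0 → cexp w • ζ ∈ ball (0 : En n) 1 := by
    intro w hw
    rw [mem_ball_zero_iff, nrm, Real.exp_lt_one_iff]; exact hw
  have hpt : ∀ t θ : ℝ, Real.exp t • (cexp (θ * I) • ζ) = cexp (wpt t θ) • ζ := by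
    intro t θ
    rw [real_smul_En, smul_smul, wpt, Complex.exp_add, Complex.ofReal_exp]
  set G : ℂ → l2 := fun w => f (cexp w • ζ) with hG
  have dG : ∀ w : ℂ, w.re < 0 → HasDerivAt G (radD f (cexp w • ζ)) w := fun w hw =>
    slice_deriv hf (mem w hw)
  have hGd : DifferentiableOn ℂ G {w | w.re < 0} := fun w hw =>
    (dG w hw).differentiableAt.differentiableWithinAt
  have hper : ∀ w, G (w + 2 * Real.pi * I) = G w := by
    intro w; simp only [hG]; rw [Complex.exp_periodic w]
  have hD : ∀ θ : ℝ, ‖deriv G (wpt a θ)‖ ≤ M * Real.exp a := by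
    intro θ
    rw [(dG _ (by rw [wpt_re]; linarith)).deriv]
    have h := hM (cexp (wpt a θ) • ζ)
    rw [nrm, wpt_re] at h
    apply h
    have := Real.exp_neg_one_lt_half
    have := Real.exp_le_exp.2 ha
    linarith
  have main := slice_lint hGd hper haT hT hε hD
  convert main using 1
  · apply lintegral_congr
    intro θ
    apply setLIntegral_congr_fun measurableSet_Ioc
    intro t ht
    have hw : (wpt t θ).re < 0 := by rw [wpt_re]; exact lt_of_le_of_lt ht.2 hT
    simp only
    rw [hpt, (dG _ hw).deriv, kap, NR, NF, indicator_of_mem (mem _ hw), indicator_of_mem (mem _ hw)]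
    rfl
  · congr 1
    apply lintegral_congr
    intro θ
    have hw : (wpt T θ).re < 0 := by rw [wpt_re]; exact hT
    rw [hpt, NF, indicator_of_mem (mem _ hw)]

lemma step {n : ℕ} (hn : 1 ≤ n) {f : En n → l2}
    (hf : DifferentiableOn ℂ f (ball (0 : En n) 1)) {M : ℝ} (hM0 : 0 ≤ M)
    (hM : ∀ z : En n, ‖z‖ ≤ 1 / 2 → ‖radD f z‖ ≤ M * ‖z‖) {a T ε : ℝ}
    (ha : a ≤ -1) (haT : a < T) (hT : T < 0) (hε : 0 < ε) :
    ∫⁻ z, Phi f a T ε z ≤ (volume : Measure (En n)).toSphere univ * h1Ball f +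
      (volume : Measure (En n)).toSphere univ * ENNReal.ofReal (ε + (T - a) * (M * Real.exp a)) := by
  have : Nonempty (Fin n) := ⟨⟨0, hn⟩⟩
  set ν := (volume : Measure (En n)).toSphere with hν
  have hν0 : ν univ ≠ 0 := by
    rw [Measure.measure_univ_ne_zero]
    exact Measure.toSphere_ne_zero _
  have hνt : ν univ ≠ ∞ := measure_ne_top _ _
  have hpi : (0:ℝ) < 2 * Real.pi := by positivity
  have hp0 : ENNReal.ofReal (2 * Real.pi) ≠ 0 := by simpa using hpi
  have mk := meas_kap hf ε
  have mNF : Measurable (NF f) := meas_f hf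
  have m1 : Measurable (fun ζ : En n => ∫⁻ t in Ioc a T,
      ENNReal.ofReal ((T - t) * kap f ε (Real.exp t • ζ))) := by
    apply Measurable.lintegral_prod_right (f := fun (ζ : En n) (t : ℝ) =>
      ENNReal.ofReal ((T - t) * kap f ε (Real.exp t • ζ)))
    simp only [Function.uncurry_def]
    apply ENNReal.measurable_ofReal.comp
    apply Measurable.mul (by fun_prop)
    apply mk.comp
    apply Continuous.measurable
    fun_prop
  have m2 : Measurable (fun ζ : En n => ENNReal.ofReal (NF f (Real.exp T • ζ))) := by
    apply ENNReal.measurable_ofReal.comp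
    apply mNF.comp
    apply Continuous.measurable
    fun_prop
  have key : ENNReal.ofReal (2 * Real.pi) * ∫⁻ z, Phi f a T ε z ≤ ENNReal.ofReal (2 * Real.pi) *
      ((∫⁻ ζ : sphere (0 : En n) 1, ENNReal.ofReal (NF f (Real.exp T • (ζ : En n))) ∂ν) +
        ν univ * ENNReal.ofReal (ε + (T - a) * (M * Real.exp a))) := by
    rw [Phi_int hn hf, ← avg_rot m1, mul_add, ← avg_rot m2]
    calc _ ≤ _ := lintegral_mono fun ζ : sphere (0 : En n) 1 =>
          slice_app hf hM ha haT hT hε (ζ := (ζ : En n)) (by simp)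
      _ = _ := by
        rw [lintegral_add_right _ measurable_const, lintegral_const, ENNReal.ofReal_mul hpi.le]
        ring
  have key2 := (ENNReal.mul_le_mul_iff_right hp0 ENNReal.ofReal_ne_top).1 key
  refine key2.trans ?_
  gcongr
  have hT1 : Real.exp T < 1 := Real.exp_lt_one_iff.2 hT
  have e1 : ∫⁻ ζ : sphere (0 : En n) 1, ENNReal.ofReal ‖f (Real.exp T • (ζ : En n))‖ ∂(sphereM n)
      ≤ h1Ball f := by
    unfold h1Ball
    exact le_iSup₂ (f := fun (r : ℝ) (_ : r ∈ Ioo (0 : ℝ) 1) =>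
      ∫⁻ ζ : sphere (0 : En n) 1, ENNReal.ofReal ‖f (r • (ζ : En n))‖ ∂(sphereM n))
      (Real.exp T) ⟨Real.exp_pos T, hT1⟩
  calc _ = ∫⁻ ζ : sphere (0 : En n) 1, ENNReal.ofReal ‖f (Real.exp T • (ζ : En n))‖ ∂ν := by
        apply lintegral_congr
        intro ζ
        rw [NF, indicator_of_mem]
        rw [mem_ball_zero_iff, norm_smul, Real.norm_of_nonneg (Real.exp_pos T).le]
        simpa using hT
    _ = ν univ * ∫⁻ ζ : sphere (0 : En n) 1,
          ENNReal.ofReal ‖f (Real.exp T • (ζ : En n))‖ ∂(sphereM n) := by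
        rw [sphereM, lintegral_smul_measure, smul_eq_mul, ← mul_assoc,
          ENNReal.mul_inv_cancel hν0 hνt, one_mul]
    _ ≤ _ := by gcongr

open Filter

/-- Inequality (1in): for holomorphic `f : B_n → ℓ²`, `f ≢ 0`,
`∫_{B_n} (‖Rf‖²/‖f‖) |z|^{-2n} log(1/|z|) dV ≤ C(n) ‖f‖_{H¹(B_n;ℓ²)}`. -/
theorem radial_green_bound (n : ℕ) (hn : 1 ≤ n) :
    ∃ C : ℝ, 0 < C ∧
      ∀ f : En n → l2,
        DifferentiableOn ℂ f (ball (0 : En n) 1) →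
        (∃ z ∈ ball (0 : En n) 1, f z ≠ 0) →
        (∫⁻ z in ball (0 : En n) 1,
            ENNReal.ofReal
              (‖radD f z‖ ^ 2 / ‖f z‖ *
                (‖z‖ ^ (-2 * (n : ℝ)) * Real.log (1 / ‖z‖))) ∂volume) ≤
          ENNReal.ofReal C * h1Ball f := by
  have : Nonempty (Fin n) := ⟨⟨0, hn⟩⟩
  have hνt : (volume : Measure (En n)).toSphere univ ≠ ∞ := measure_ne_top _ _
  have hν0 : (volume : Measure (En n)).toSphere univ ≠ 0 := by
    rw [Measure.measure_univ_ne_zero]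
    exact Measure.toSphere_ne_zero _
  refine ⟨((volume : Measure (En n)).toSphere univ).toReal, ENNReal.toReal_pos hν0 hνt, ?_⟩
  intro f hf _
  rw [ENNReal.ofReal_toReal hνt]
  obtain ⟨M, hM0, hM⟩ := radD_bound hf
  let a : ℕ → ℝ := fun k => -((k : ℝ) + 2)
  let T : ℕ → ℝ := fun k => -(1 / ((k : ℝ) + 1))
  let ε : ℕ → ℝ := fun k => 1 / ((k : ℝ) + 1)
  have hε : ∀ k, 0 < ε k := fun k => by simp only [ε]; positivity
  have hT : ∀ k, T k < 0 := fun k => neg_neg_iff_pos.2 (hε k)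
  have hT1 : ∀ k, -1 ≤ T k := fun k => by
    simp only [T]
    apply neg_le_neg
    rw [div_le_one (by positivity)]; linarith [Nat.cast_nonneg (α := ℝ) k]
  have ha : ∀ k, a k ≤ -1 := fun k => by
    simp only [a]; linarith [Nat.cast_nonneg (α := ℝ) k]
  have haT : ∀ k, a k < T k := fun k => by
    have := hT1 k
    simp only [a]; linarith [Nat.cast_nonneg (α := ℝ) k]
  have lε : Tendsto ε atTop (𝓝 0) := tendsto_one_div_add_atTop_nhds_zero_nat
  have lT : Tendsto T atTop (𝓝 0) := by simpa using lε.neg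
  have la : Tendsto a atTop atBot :=
    tendsto_neg_atTop_atBot.comp
      (tendsto_atTop_add_const_right _ 2 tendsto_natCast_atTop_atTop)
  -- error term
  have lerr : Tendsto (fun k => ε k + (T k - a k) * (M * Real.exp (a k))) atTop (𝓝 0) := by
    have h1 : Tendsto (fun k => a k * Real.exp (a k)) atTop (𝓝 0) := by
      have h := (Real.tendsto_pow_mul_exp_neg_atTop_nhds_zero 1).comp (tendsto_neg_atBot_atTop.comp la)
      have h' := h.neg
      simpa [Function.comp_def] using h'
    have h2 : Tendsto (fun k => Real.exp (a k)) atTop (𝓝 0) := Real.tendsto_exp_atBot.comp la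
    have h3 := lε.add (((lT.mul h2).sub h1).const_mul M)
    simp only [mul_zero, sub_zero, add_zero] at h3
    refine h3.congr fun k => ?_
    ring
  set ν := (volume : Measure (En n)).toSphere univ with hν
  have lR : Tendsto (fun k => ν * h1Ball f +
      ν * ENNReal.ofReal (ε k + (T k - a k) * (M * Real.exp (a k)))) atTop (𝓝 (ν * h1Ball f)) := by
    have h1 := ENNReal.tendsto_ofReal lerr
    have h2 := ENNReal.Tendsto.const_mul (a := ν) h1 (Or.inr hνt)
    have h3 := (tendsto_const_nhds (x := ν * h1Ball f)).add h2
    simpa using h3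
  rw [← lintegral_indicator measurableSet_ball]
  calc _ ≤ ∫⁻ z, liminf (fun k => Phi f (a k) (T k) (ε k) z) atTop := by
        apply lintegral_mono
        intro z
        by_cases hz : z ∈ ball (0 : En n) 1
        swap
        · simp only [indicator_of_notMem hz]; exact bot_le
        simp only [indicator_of_mem hz]
        rcases eq_or_ne z 0 with rfl | hz0
        · simp
        rcases eq_or_ne (f z) 0 with hfz | hfz
        · simp [hfz]
        have hzn : 0 < ‖z‖ := norm_pos_iff.2 hz0
        have hl : Real.log ‖z‖ < 0 := Real.log_neg hzn (by simpa using hz)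
        have lim : Tendsto (fun k => Phi f (a k) (T k) (ε k) z) atTop (𝓝 (ENNReal.ofReal
              (‖radD f z‖ ^ 2 / ‖f z‖ *
                (‖z‖ ^ (-2 * (n : ℝ)) * Real.log (1 / ‖z‖))))) := by
          have e1 : ∀ᶠ k in atTop, ENNReal.ofReal (Real.exp (-(2 * n * Real.log ‖z‖)) *
              ((T k - Real.log ‖z‖) * (‖radD f z‖ ^ 2 / Real.sqrt (‖f z‖ ^ 2 + ε k ^ 2)))) =
              Phi f (a k) (T k) (ε k) z := by
            filter_upwards [la.eventually_lt_atBot (Real.log ‖z‖),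
              lT.eventually (lt_mem_nhds hl)] with k h1 h2
            have hm : z ∈ {z : En n | Real.log ‖z‖ ∈ Ioc (a k) (T k)} := ⟨h1, h2.le⟩
            rw [Phi, indicator_of_mem hm, kap, NF, NR, indicator_of_mem hz, indicator_of_mem hz]
          refine Tendsto.congr' e1 ?_
          apply ENNReal.tendsto_ofReal
          have hfn : ‖f z‖ ≠ 0 := norm_ne_zero_iff.2 hfz
          have l1 : Tendsto (fun k => Real.sqrt (‖f z‖ ^ 2 + ε k ^ 2)) atTop (𝓝 ‖f z‖) := by
            have := (((lε.pow 2).const_add (‖f z‖ ^ 2)).sqrt)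
            simpa using this
          have l2' := ((lT.sub_const (Real.log ‖z‖)).mul
            ((tendsto_const_nhds (x := ‖radD f z‖ ^ 2)).div l1 hfn)).const_mul
              (Real.exp (-(2 * n * Real.log ‖z‖)))
          have e2 : ‖radD f z‖ ^ 2 / ‖f z‖ * (‖z‖ ^ (-2 * (n : ℝ)) * Real.log (1 / ‖z‖)) =
              Real.exp (-(2 * n * Real.log ‖z‖)) *
                ((0 - Real.log ‖z‖) * (‖radD f z‖ ^ 2 / ‖f z‖)) := by
            rw [Real.rpow_def_of_pos hzn, one_div, Real.log_inv]
            rw [show Real.log ‖z‖ * (-2 * (n:ℝ)) = -(2 * n * Real.log ‖z‖) by ring]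
            ring
          rw [e2]
          exact l2'
        rw [lim.liminf_eq]
    _ ≤ liminf (fun k => ∫⁻ z, Phi f (a k) (T k) (ε k) z) atTop :=
        lintegral_liminf_le fun k => meas_Phi hf _ _ _
    _ ≤ liminf (fun k => ν * h1Ball f +
          ν * ENNReal.ofReal (ε k + (T k - a k) * (M * Real.exp (a k)))) atTop :=
        liminf_le_liminf (.of_forall fun k => step hn hf hM0 hM (ha k) (haT k) (hT k) (hε k))
    _ = ν * h1Ball f := lR.liminf_eq
end
end

section
/- Let 0 < p < ∞ and let f : closure(B_n) → ℓ² be continuous on the closed unit ball and holomorphic on B_n. Then for every z ∈ B_n, ‖f(z)‖_{ℓ²}^{p/2} ≤ ∫_{∂B_n} ( (1−|z|²) / |1−⟨z,ζ⟩|² )^n ‖f(ζ)‖_{ℓ²}^{p/2} dσ(ζ); that is, ‖f‖^{p/2} is dominated by its invariant Poisson integral. -/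
open MeasureTheory Metric Set Complex Topology
open scoped ENNReal NNReal

noncomputable section

open Filter in
lemma scalar_submean (q : ℝ) (hq : 0 < q) (h : ℂ → ℂ)
    (hh : AnalyticOnNhd ℂ h (closedBall 0 1)) :
    ‖h 0‖ ^ q ≤ Real.circleAverage (fun x => ‖h x‖ ^ q) 0 1 := by
  have hcont : ContinuousOn h (closedBall 0 1) := hh.continuousOn
  have hmaps : ∀ θ : ℝ, circleMap 0 1 θ ∈ closedBall (0:ℂ) 1 := fun θ => by
    simp [circleMap]
  have hcomp : Continuous fun θ : ℝ => h (circleMap 0 1 θ) :=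
    hcont.comp_continuous (continuous_circleMap 0 1) hmaps
  by_cases h0 : h 0 = 0
  · rw [h0, norm_zero, Real.zero_rpow hq.ne']
    rw [Real.circleAverage_def]
    refine smul_nonneg (by positivity) ?_
    refine intervalIntegral.integral_nonneg (by positivity) (fun θ _ => by positivity)
  · have hh1 : AnalyticOnNhd ℂ h (closedBall 0 |(1:ℝ)|) := by simpa using hh
    have hJ := hh1.circleAverage_log_norm one_ne_zero h0
    have hge : Real.log ‖h 0‖ ≤ Real.circleAverage (fun x => Real.log ‖h x‖) 0 1 := by
      rw [hJ]
      have : 0 ≤ ∑ᶠ u, (MeromorphicOn.divisor h (closedBall 0 |(1:ℝ)|) u : ℝ)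
          * Real.log (1 * ‖0 - u‖⁻¹) := by
        refine finsum_nonneg fun u => ?_
        by_cases hu : u ∈ closedBall (0:ℂ) |(1:ℝ)|
        · refine mul_nonneg ?_ ?_
          · have := MeromorphicOn.AnalyticOnNhd.divisor_nonneg hh1 u
            exact_mod_cast this
          · have hu' : ‖u‖ ≤ 1 := by simpa using hu
            rw [zero_sub, norm_neg, one_mul, Real.log_inv]
            have := Real.log_nonpos (norm_nonneg u) hu'
            linarith
        · rw [Function.locallyFinsuppWithin.apply_eq_zero_of_notMem _ hu]
          simp
      linarith
    have hcod : (fun x => Real.exp (q * Real.log ‖h x‖)) =ᶠ[codiscreteWithin (sphere 0 |(1:ℝ)|)]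
        fun x => ‖h x‖ ^ q := by
      have h1 : h ⁻¹' {0}ᶜ ∈ codiscreteWithin (closedBall 0 |(1:ℝ)|) :=
        hh1.preimage_zero_mem_codiscreteWithin h0 (by simp)
          ⟨⟨0, by simp⟩, (convex_closedBall _ _).isPreconnected⟩
      have h2 := codiscreteWithin_mono (sphere_subset_closedBall) h1
      filter_upwards [h2] with x hx
      have : h x ≠ 0 := hx
      rw [Real.rpow_def_of_pos (norm_pos_iff.mpr this), mul_comm]
    rw [← Real.circleAverage_congr_codiscreteWithin hcod one_ne_zero]
    have hint : CircleIntegrable (fun x => Real.log ‖h x‖) 0 1 :=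
      (hh1.mono sphere_subset_closedBall).meromorphicOn.circleIntegrable_log_norm
    have hint2 : CircleIntegrable (fun x => Real.exp (q * Real.log ‖h x‖)) 0 1 := by
      have : CircleIntegrable (fun x => ‖h x‖ ^ q) 0 1 := by
        apply Continuous.intervalIntegrable
        exact (hcomp.norm).rpow_const (fun _ => Or.inr hq.le)
      exact this.congr_codiscreteWithin hcod.symm
    calc ‖h 0‖ ^ q = Real.exp (q * Real.log ‖h 0‖) := by
          rw [Real.rpow_def_of_pos (norm_pos_iff.mpr h0), mul_comm]
      _ ≤ Real.exp (q * Real.circleAverage (fun x => Real.log ‖h x‖) 0 1) := by gcongr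
      _ ≤ _ := by
        rw [Real.circleAverage_eq_intervalAverage, Real.circleAverage_eq_intervalAverage]
        have : NeZero (volume.restrict (Set.Ioc (0:ℝ) (2*Real.pi))) := ⟨by
          rw [Ne, Measure.restrict_eq_zero]; simp [Real.pi_pos]⟩
        have := ConvexOn.map_average_le (μ := volume.restrict (Set.Ioc (0:ℝ) (2*Real.pi)))
          (f := fun θ => Real.log ‖h (circleMap 0 1 θ)‖) (g := fun y => Real.exp (q * y)) (s := univ)
          (by
            have := convexOn_exp.comp_linearMap (LinearMap.lsmul ℝ ℝ q)
            simpa [Function.comp_def] using this) (by fun_prop) isClosed_univ (by simp)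
          hint.1 hint2.1
        rw [Set.uIoc_of_le (by positivity)]
        exact this

open Filter in
lemma vec_submean (q : ℝ) (hq : 0 < q) (F : ℂ → l2)
    (hF : AnalyticOnNhd ℂ F (closedBall 0 1)) :
    ENNReal.ofReal (2 * Real.pi) * ENNReal.ofReal (‖F 0‖ ^ q) ≤
      ∫⁻ θ in Ioc 0 (2 * Real.pi), ENNReal.ofReal (‖F (circleMap 0 1 θ)‖ ^ q) := by
  have hmaps : ∀ θ : ℝ, circleMap 0 1 θ ∈ closedBall (0:ℂ) 1 := fun θ => by
    simp [circleMap]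
  have hcomp : Continuous fun θ : ℝ => F (circleMap 0 1 θ) :=
    hF.continuousOn.comp_continuous (continuous_circleMap 0 1) hmaps
  have hcr := (hcomp.norm).rpow_const (p := q) (fun _ => Or.inr hq.le)
  by_cases h0 : F 0 = 0
  · simp [h0, Real.zero_rpow hq.ne']
  obtain ⟨e, he1, he2⟩ := exists_dual_vector ℂ (F 0) (norm_ne_zero_iff.mpr h0)
  have ha : AnalyticOnNhd ℂ (fun x => e (F x)) (closedBall 0 1) :=
    fun x hx => (e.analyticAt _).comp (hF x hx)
  have h1 := scalar_submean q hq _ ha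
  have hle : ∀ x, ‖e (F x)‖ ≤ ‖F x‖ := fun x => by
    simpa [he1] using e.le_opNorm (F x)
  have hcomp2 : Continuous fun θ : ℝ => e (F (circleMap 0 1 θ)) := e.continuous.comp hcomp
  have hcr2 := (hcomp2.norm).rpow_const (p := q) (fun _ => Or.inr hq.le)
  have h2 : Real.circleAverage (fun x => ‖e (F x)‖ ^ q) 0 1 ≤
      Real.circleAverage (fun x => ‖F x‖ ^ q) 0 1 := by
    refine Real.circleAverage_mono ?_ ?_ ?_
    · exact hcr2.intervalIntegrable _ _
    · exact hcr.intervalIntegrable _ _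
    · intro x hx
      exact Real.rpow_le_rpow (norm_nonneg _) (hle x) hq.le
  have h3 : ‖F 0‖ ^ q ≤ Real.circleAverage (fun x => ‖F x‖ ^ q) 0 1 := by
    refine le_trans (le_of_eq ?_) (h1.trans h2)
    simp [he2]
  rw [Real.circleAverage_def, smul_eq_mul, intervalIntegral.integral_of_le (by positivity)] at h3
  rw [← ofReal_integral_eq_lintegral_ofReal, ← ENNReal.ofReal_mul (by positivity)]
  · apply ENNReal.ofReal_le_ofReal
    rwa [inv_mul_eq_div, le_div_iff₀ (by positivity), mul_comm] at h3
  · exact (hcr.intervalIntegrable 0 (2*Real.pi)).1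
  · exact Eventually.of_forall fun θ => by positivity

lemma herm_eq_inner {n : ℕ} (z w : En n) : herm z w = inner ℂ w z := by
  simp [herm, PiLp.inner_apply]

/-- the projective map -/
def psi {n : ℕ} (z : En n) (m : En n) : En n :=
  z + (((1 - ‖z‖ ^ 2 : ℝ) : ℂ) / (1 + inner ℂ z m)) • m

def psiD {n : ℕ} (z : En n) (m : En n) : En n →L[ℂ] En n :=
  (((1 - ‖z‖ ^ 2 : ℝ) : ℂ) / (1 + inner ℂ z m)) • (ContinuousLinearMap.id ℂ (En n) +
    (innerSL ℂ z).smulRight (-(1 / (1 + inner ℂ z m)) • m))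

/-- the quadratic form -/
def qf {n : ℕ} (z : En n) (m : En n) : ℝ := (1 - ‖z‖ ^ 2) * ‖m‖ ^ 2 + ‖(inner ℂ z m : ℂ)‖ ^ 2

lemma det_transv {n : ℕ} (a : ℂ) (L : En n →L[ℂ] ℂ) (v : En n) :
    ((a • (ContinuousLinearMap.id ℂ (En n) + L.smulRight v)).restrictScalars ℝ).det
      = (‖a‖ ^ 2) ^ n * ‖1 + L v‖ ^ 2 := by
  have h1 : (((a • (ContinuousLinearMap.id ℂ (En n) + L.smulRight v)).restrictScalars ℝ :
      En n →L[ℝ] En n) : En n →ₗ[ℝ] En n)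
      = LinearMap.restrictScalars ℝ (a • LinearMap.transvection (L : En n →ₗ[ℂ] ℂ) v) := by
    ext x i
    simp [LinearMap.transvection]
  rw [ContinuousLinearMap.det, h1, LinearMap.det_restrictScalars, LinearMap.det_smul,
    LinearMap.transvection.det, map_mul, map_pow, Algebra.norm_complex_apply,
    Algebra.norm_complex_apply, finrank_euclideanSpace_fin, Complex.normSq_eq_norm_sq,
    Complex.normSq_eq_norm_sq]
  rfl

lemma psi_hasFDerivAt {n : ℕ} (z m : En n) (hd : 1 + inner ℂ z m ≠ (0:ℂ)) :
    HasFDerivAt (psi z) (psiD z m) m := by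
  have h1 : HasFDerivAt (fun m : En n => (1 + inner ℂ z m : ℂ)) (innerSL ℂ z) m :=
    ((innerSL ℂ z).hasFDerivAt).const_add 1
  have h2 := ((hasDerivAt_inv hd).comp_hasFDerivAt m h1).const_mul (((1 - ‖z‖ ^ 2 : ℝ) : ℂ))
  have h3 := (h2.smul (hasFDerivAt_id m)).const_add z
  refine (h3.congr_fderiv ?_).congr_of_eventuallyEq ?_
  · ext x i
    simp [psiD]
    field_simp
  · refine Filter.Eventually.of_forall fun y => ?_
    simp [psi, div_eq_mul_inv]

lemma psi_jac {n : ℕ} (z m : En n) (hz : ‖z‖ < 1) (hd : 1 + inner ℂ z m ≠ (0:ℂ)) :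
    |((psiD z m).restrictScalars ℝ).det| = (1 - ‖z‖ ^ 2) ^ (2 * n) / 
      (‖(1 + inner ℂ z m : ℂ)‖ ^ 2) ^ (n + 1) := by
  have hs : 0 < 1 - ‖z‖ ^ 2 := by nlinarith [norm_nonneg z]
  have hd' := norm_pos_iff.mpr hd
  rw [psiD, det_transv, abs_of_nonneg (by positivity)]
  have : (1 : ℂ) + (innerSL ℂ z) (-(1 / (1 + inner ℂ z m)) • m) = (1 + inner ℂ z m)⁻¹ := by
    rw [map_smul, innerSL_apply_apply, smul_eq_mul]
    field_simp
    ring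
  rw [this, norm_div, norm_inv, Complex.norm_real, Real.norm_of_nonneg hs.le]
  rw [div_pow, div_pow, pow_mul]
  field_simp
  ring

lemma psi_zero {n : ℕ} (z : En n) : psi z 0 = z := by simp [psi]

lemma one_sub_inner_psi {n : ℕ} (z m : En n) (hd : 1 + inner ℂ z m ≠ (0:ℂ)) :
    1 - inner ℂ z (psi z m) = ((1 - ‖z‖ ^ 2 : ℝ) : ℂ) / (1 + inner ℂ z m) := by
  rw [psi, inner_add_right, inner_smul_right, inner_self_eq_norm_sq_to_K]
  push_cast
  field_simp
  simp
  ring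

lemma one_sub_norm_psi {n : ℕ} (z m : En n) (hd : 1 + inner ℂ z m ≠ (0:ℂ)) :
    1 - ‖psi z m‖ ^ 2 = (1 - ‖z‖ ^ 2) * (1 - qf z m) / ‖(1 + inner ℂ z m : ℂ)‖ ^ 2 := by
  have hd' := norm_pos_iff.mpr hd
  rw [psi, norm_add_sq (𝕜 := ℂ), inner_smul_right, norm_smul, qf, norm_div, Complex.norm_real]
  set s := 1 - ‖z‖ ^ 2 with hs
  set b : ℂ := inner ℂ z m with hb
  have h1 : RCLike.re ((s : ℂ) / (1 + b) * b) = s * (‖b‖ ^ 2 + b.re) / ‖1 + b‖ ^ 2 := by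
    have : (s : ℂ) / (1 + b) * b = ((s / ‖1 + b‖ ^ 2 : ℝ) : ℂ) * (starRingEnd ℂ (1 + b) * b) := by
      have h2 : (starRingEnd ℂ (1 + b)) * (1 + b) = ((‖1 + b‖ ^ 2 : ℝ) : ℂ) := by
        rw [mul_comm, Complex.mul_conj, Complex.normSq_eq_norm_sq]
      push_cast
      push_cast at h2
      rw [← h2]
      have : (starRingEnd ℂ (1 + b)) ≠ 0 := (map_ne_zero _).mpr hd
      field_simp
    rw [this]
    simp only [RCLike.re_to_complex]
    rw [Complex.re_ofReal_mul, ← Complex.normSq_eq_norm_sq, ← Complex.normSq_eq_norm_sq,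
      Complex.normSq_apply b]
    simp
    ring
  have h3 : ‖1 + b‖ ^ 2 = 1 + 2 * b.re + ‖b‖ ^ 2 := by
    rw [← Complex.normSq_eq_norm_sq, ← Complex.normSq_eq_norm_sq,
      Complex.normSq_apply, Complex.normSq_apply]
    simp
    ring
  rw [h1, Real.norm_eq_abs, mul_pow, div_pow, sq_abs]
  field_simp
  have hz : ‖z‖ ^ 2 = 1 - s := by rw [hs]; ring
  rw [hz, h3]
  ring

lemma qf_smul {n : ℕ} (z m : En n) (c : ℂ) : qf z (c • m) = ‖c‖ ^ 2 * qf z m := by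
  simp [qf, norm_smul]; ring

lemma inner_ne {n : ℕ} (z m : En n) (hz : ‖z‖ < 1) (hm : qf z m < 1) :
    1 + inner ℂ z m ≠ (0:ℂ) := by
  intro h
  have h1 : (inner ℂ z m : ℂ) = -1 := by linear_combination h
  have hs : 0 < 1 - ‖z‖ ^ 2 := by nlinarith [norm_nonneg z]
  rw [qf, h1] at hm
  simp at hm
  nlinarith [sq_nonneg ‖m‖]

lemma psi_mem {n : ℕ} (z m : En n) (hz : ‖z‖ < 1) (hm : qf z m < 1) : ‖psi z m‖ < 1 := by
  have hd := inner_ne z m hz hm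
  have h := one_sub_norm_psi z m hd
  have hs : 0 < 1 - ‖z‖ ^ 2 := by nlinarith [norm_nonneg z]
  have hd' := norm_pos_iff.mpr hd
  have : 0 < 1 - ‖psi z m‖ ^ 2 := by
    rw [h]; have : 0 < 1 - qf z m := by linarith
    positivity
  nlinarith [norm_nonneg (psi z m)]

lemma psi_inj {n : ℕ} (z : En n) (hz : ‖z‖ < 1) : InjOn (psi z) {m | qf z m < 1} := by
  have hs : 0 < 1 - ‖z‖ ^ 2 := by nlinarith [norm_nonneg z]
  have hs' : ((1 - ‖z‖ ^ 2 : ℝ) : ℂ) ≠ 0 := by exact_mod_cast hs.ne'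
  have key : ∀ m, qf z m < 1 → m = (1 - inner ℂ z (psi z m))⁻¹ • (psi z m - z) := by
    intro m hm
    have hd := inner_ne z m hz hm
    rw [one_sub_inner_psi z m hd, psi, add_sub_cancel_left, smul_smul, inv_mul_cancel₀, one_smul]
    exact div_ne_zero hs' hd
  intro m hm m' hm' h
  rw [key m hm, key m' hm', h]

/-- a linear square root of `qf` -/
lemma exists_sqrt {n : ℕ} (hn : 1 ≤ n) (z : En n) (hz : ‖z‖ < 1) : ∃ A : En n →L[ℝ] En n,
    A.det = (1 - ‖z‖ ^ 2) ^ (n - 1) ∧ ∀ m, ‖A m‖ ^ 2 = qf z m := by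
  have hs : 0 < 1 - ‖z‖ ^ 2 := by nlinarith [norm_nonneg z]
  obtain ⟨r, hr, hrs⟩ : ∃ r : ℝ, 0 < r ∧ r ^ 2 = 1 - ‖z‖ ^ 2 :=
    ⟨Real.sqrt (1 - ‖z‖ ^ 2), Real.sqrt_pos.mpr hs, Real.sq_sqrt hs.le⟩
  have hz2 : ‖z‖ ^ 2 = 1 - r ^ 2 := by linarith
  refine ⟨((r : ℂ) • (ContinuousLinearMap.id ℂ (En n) +
    (innerSL ℂ z).smulRight (((1 / (r * (1 + r)) : ℝ) : ℂ) • z))).restrictScalars ℝ, ?_, ?_⟩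
  · rw [det_transv]
    have : 1 + (innerSL ℂ z) (((1 / (r * (1 + r)) : ℝ) : ℂ) • z) = ((1 / r : ℝ) : ℂ) := by
      rw [map_smul, innerSL_apply_apply, inner_self_eq_norm_sq_to_K]
      simp only [smul_eq_mul, RCLike.ofReal_eq_complex_ofReal]
      norm_cast
      rw [hz2]
      field_simp
      ring
    rw [this, ← hrs, Complex.norm_real, Complex.norm_real, Real.norm_of_nonneg hr.le,
      Real.norm_of_nonneg (by positivity)]
    obtain ⟨k, rfl⟩ := Nat.exists_eq_add_of_le' hn
    simp only [Nat.add_sub_cancel]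
    rw [pow_succ]
    field_simp
  · intro m
    simp only [ContinuousLinearMap.coe_restrictScalars', smul_apply,
      add_apply, ContinuousLinearMap.id_apply,
      ContinuousLinearMap.smulRight_apply, innerSL_apply_apply]
    rw [norm_smul, mul_pow, Complex.norm_real, Real.norm_of_nonneg hr.le,
      norm_add_sq (𝕜 := ℂ), smul_smul, inner_smul_right, norm_smul, norm_mul, Complex.norm_real,
      Real.norm_of_nonneg (by positivity), qf]
    have : inner ℂ m z = starRingEnd ℂ (inner ℂ z m) := (inner_conj_symm _ _).symm
    rw [this]
    have h2 : RCLike.re ((inner ℂ z m : ℂ) * ((1 / (r * (1 + r)) : ℝ) : ℂ) *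
        (starRingEnd ℂ (inner ℂ z m))) = (1 / (r * (1 + r))) * ‖(inner ℂ z m : ℂ)‖ ^ 2 := by
      rw [mul_right_comm, Complex.mul_conj, Complex.normSq_eq_norm_sq]
      simp only [RCLike.re_to_complex]
      norm_cast
      ring
    rw [h2, mul_pow, hz2]
    field_simp
    ring

lemma qf_continuous {n : ℕ} (z : En n) : Continuous (qf z) := by
  unfold qf
  fun_prop

lemma isOpen_E {n : ℕ} (z : En n) : IsOpen {m | qf z m < 1} :=
  isOpen_lt (qf_continuous z) continuous_const

lemma psi_continuousOn {n : ℕ} (z : En n) (hz : ‖z‖ < 1) :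
    ContinuousOn (psi z) {m | qf z m < 1} := fun m hm =>
  (psi_hasFDerivAt z m (inner_ne z m hz hm)).continuousAt.continuousWithinAt

lemma slice_submean {n : ℕ} (q : ℝ) (hq : 0 < q) (f : En n → l2)
    (hf : DifferentiableOn ℂ f (ball (0 : En n) 1))
    (z : En n) (hz : ‖z‖ < 1) (m : En n) (hm : qf z m < 1) :
    ENNReal.ofReal (2 * Real.pi) * ENNReal.ofReal (‖f z‖ ^ q) ≤
      ∫⁻ θ in Ioc 0 (2 * Real.pi), ENNReal.ofReal (‖f (psi z (circleMap 0 1 θ • m))‖ ^ q) := by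
  have hopen : IsOpen {c : ℂ | qf z (c • m) < 1} :=
    isOpen_lt ((qf_continuous z).comp (by fun_prop)) continuous_const
  have hd : DifferentiableOn ℂ (fun c : ℂ => f (psi z (c • m))) {c : ℂ | qf z (c • m) < 1} := by
    intro c hc
    have h1 : DifferentiableAt ℂ f (psi z (c • m)) :=
      (hf _ (by simpa using psi_mem z _ hz hc)).differentiableAt
        (isOpen_ball.mem_nhds (by simpa using psi_mem z _ hz hc))
    have h2 : DifferentiableAt ℂ (psi z) (c • m) :=
      (psi_hasFDerivAt z _ (inner_ne z _ hz hc)).differentiableAt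
    have h3 : DifferentiableAt ℂ (fun c : ℂ => c • m) c := by fun_prop
    exact ((h1.comp (c • m) h2).comp c h3).differentiableWithinAt
  have ha := (hd.analyticOnNhd hopen).mono (t := {c : ℂ | qf z (c • m) < 1})
    (s := closedBall 0 1) (by
      intro c hc
      have hc' : ‖c‖ ≤ 1 := by simpa using hc
      have hs : 0 < 1 - ‖z‖ ^ 2 := by nlinarith [norm_nonneg z]
      have : 0 ≤ qf z m := by unfold qf; positivity
      have h1 : ‖c‖ ^ 2 ≤ 1 := by nlinarith [norm_nonneg c]
      show qf z (c • m) < 1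
      rw [qf_smul]
      nlinarith)
  simpa [psi_zero] using vec_submean q hq _ ha

lemma mp_smul {n : ℕ} (c : ℂ) (hc : ‖c‖ = 1) :
    MeasurePreserving (fun m : En n => c • m) volume volume := by
  have h0 : c ≠ 0 := by rintro rfl; simp at hc
  let e : En n ≃ₗᵢ[ℝ] En n :=
    { (LinearEquiv.smulOfNeZero ℂ (En n) c h0).restrictScalars ℝ with
      norm_map' := fun x => by
        show ‖c • x‖ = ‖x‖
        rw [norm_smul, hc, one_mul] }
  exact e.measurePreserving

lemma step2 {n : ℕ} (q : ℝ) (hq : 0 < q) (f : En n → l2)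
    (hf : DifferentiableOn ℂ f (ball (0 : En n) 1))
    (z : En n) (hz : ‖z‖ < 1) (t : ℝ) :
    ENNReal.ofReal (‖f z‖ ^ q) * ∫⁻ m in {m | qf z m < 1}, ENNReal.ofReal ((1 - qf z m) ^ (t - 1))
      ≤ ∫⁻ m in {m | qf z m < 1}, ENNReal.ofReal ((1 - qf z m) ^ (t - 1)) *
        ENNReal.ofReal (‖f (psi z m)‖ ^ q) := by
  set E : Set (En n) := {m | qf z m < 1} with hE
  have hEm : MeasurableSet E := (isOpen_E z).measurableSet
  set w : En n → ℝ≥0∞ := fun m => ENNReal.ofReal ((1 - qf z m) ^ (t - 1)) with hw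
  set K : En n → ℝ≥0∞ := fun m => w m * ENNReal.ofReal (‖f (psi z m)‖ ^ q) with hK
  have hwm : Measurable w := by
    have := (qf_continuous z).measurable
    fun_prop
  have hfm : Measurable (E.indicator fun m => ENNReal.ofReal (‖f (psi z m)‖ ^ q)) := by
    classical
    rw [← Set.piecewise_eq_indicator]
    refine ContinuousOn.measurable_piecewise ?_ continuousOn_const hEm
    refine ENNReal.continuous_ofReal.comp_continuousOn ?_
    refine ContinuousOn.rpow_const ?_ (fun _ _ => Or.inr hq.le)
    exact (hf.continuousOn.comp (psi_continuousOn z hz)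
      (fun m hm => by simpa using psi_mem z m hz hm)).norm
  have hHm : Measurable (E.indicator K) := by
    have : E.indicator K = fun m => w m * (E.indicator
        fun m => ENNReal.ofReal (‖f (psi z m)‖ ^ q)) m := by
      funext m
      by_cases hm : m ∈ E <;> simp [hm, hK]
    rw [this]
    exact hwm.mul hfm
  have hpi : ENNReal.ofReal (2 * Real.pi) ≠ 0 := by simp [Real.pi_pos]
  have hcn : ∀ θ : ℝ, ‖circleMap 0 1 θ‖ = 1 := fun θ => by simp [circleMap]
  have hq1 : ∀ (θ : ℝ) m, qf z (circleMap 0 1 θ • m) = qf z m := fun θ m => by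
    rw [qf_smul, hcn]; simp
  have hrot : ∀ θ : ℝ, ∫⁻ m, E.indicator K (circleMap 0 1 θ • m) = ∫⁻ m, E.indicator K m :=
    fun θ => (mp_smul _ (hcn θ)).lintegral_comp hHm
  rw [← lintegral_indicator hEm K]
  refine (ENNReal.mul_le_mul_iff_right hpi ENNReal.ofReal_ne_top).mp ?_
  calc ENNReal.ofReal (2 * Real.pi) * (ENNReal.ofReal (‖f z‖ ^ q) * ∫⁻ m in E, w m)
      = ∫⁻ m, E.indicator (fun m => w m *
          (ENNReal.ofReal (2 * Real.pi) * ENNReal.ofReal (‖f z‖ ^ q))) m := by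
        rw [lintegral_indicator hEm, lintegral_mul_const _ hwm]; ring
    _ ≤ ∫⁻ m, ∫⁻ θ in Ioc 0 (2 * Real.pi), E.indicator K (circleMap 0 1 θ • m) := by
        refine lintegral_mono fun m => ?_
        by_cases hm : m ∈ E
        · have : ∀ θ : ℝ, E.indicator K (circleMap 0 1 θ • m) =
              w m * ENNReal.ofReal (‖f (psi z (circleMap 0 1 θ • m))‖ ^ q) := by
            intro θ
            have h1 : circleMap 0 1 θ • m ∈ E := by
              show qf z _ < 1
              rw [hq1]; exact hm
            rw [Set.indicator_of_mem h1]
            simp only [hK, hw, hq1]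
          rw [Set.indicator_of_mem hm]
          simp only [this]
          rw [lintegral_const_mul' _ _ ENNReal.ofReal_ne_top]
          gcongr
          exact slice_submean q hq f hf z hz m hm
        · rw [Set.indicator_of_notMem hm]; exact zero_le
    _ = ∫⁻ θ in Ioc 0 (2 * Real.pi), ∫⁻ m, E.indicator K (circleMap 0 1 θ • m) := by
        refine lintegral_lintegral_swap ?_
        refine Measurable.aemeasurable ?_
        have : Measurable fun p : En n × ℝ => circleMap 0 1 p.2 • p.1 := by
          refine Continuous.measurable ?_
          have := continuous_circleMap 0 1
          fun_prop
        exact hHm.comp this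
    _ = _ := by
        simp only [hrot]
        rw [lintegral_const]
        simp [mul_comm]

lemma step1 {n : ℕ} (hn : 1 ≤ n) (z : En n) (hz : ‖z‖ < 1) (t : ℝ) :
    ∫⁻ y in ball (0 : En n) 1, ENNReal.ofReal ((1 - ‖y‖ ^ 2) ^ (t - 1)) =
      ENNReal.ofReal ((1 - ‖z‖ ^ 2) ^ (n - 1)) *
      ∫⁻ m in {m | qf z m < 1}, ENNReal.ofReal ((1 - qf z m) ^ (t - 1)) := by
  obtain ⟨A, hA, hAq⟩ := exists_sqrt hn z hz
  have hs : 0 < 1 - ‖z‖ ^ 2 := by nlinarith [norm_nonneg z]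
  have hdet : LinearMap.det (A : En n →ₗ[ℝ] En n) = (1 - ‖z‖ ^ 2) ^ (n - 1) := hA
  have hmap := Measure.map_linearMap_addHaar_eq_smul_addHaar (volume : Measure (En n))
    (f := (A : En n →ₗ[ℝ] En n)) (by rw [hdet]; positivity)
  have hpre : A ⁻¹' (ball 0 1) = {m | qf z m < 1} := by
    ext m
    simp only [mem_preimage, mem_ball_zero_iff, mem_ofPred_eq, ← hAq]
    rw [sq_lt_one_iff₀ (norm_nonneg _)]
  have h1 := setLIntegral_map (μ := (volume : Measure (En n))) (g := A) (s := ball 0 1)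
    (f := fun y => ENNReal.ofReal ((1 - ‖y‖ ^ 2) ^ (t - 1))) measurableSet_ball
    (by fun_prop) A.continuous.measurable
  have hmap' : Measure.map A (volume : Measure (En n)) =
    ENNReal.ofReal |(LinearMap.det (A : En n →ₗ[ℝ] En n))⁻¹| • volume := hmap
  rw [hmap', hdet, hpre] at h1
  simp only [hAq] at h1
  rw [← h1, Measure.restrict_smul, lintegral_smul_measure, smul_eq_mul, ← mul_assoc,
    ← ENNReal.ofReal_mul (by positivity), abs_of_pos (by positivity),
    mul_inv_cancel₀ (by positivity)]
  simp

lemma step3 {n : ℕ} (hn : 1 ≤ n) (z : En n) (hz : ‖z‖ < 1) (t : ℝ) (g : En n → ℝ≥0∞) :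
    ENNReal.ofReal ((1 - ‖z‖ ^ 2) ^ (n - 1)) *
      ∫⁻ m in {m | qf z m < 1}, ENNReal.ofReal ((1 - qf z m) ^ (t - 1)) * g (psi z m) ≤ 
    ∫⁻ w in ball (0 : En n) 1, ENNReal.ofReal ((1 - ‖w‖ ^ 2) ^ (t - 1) * 
      ((1 - ‖z‖ ^ 2) / ‖(1 - inner ℂ z w : ℂ)‖ ^ 2) ^ (n + t)) * g w := by
  have hs : 0 < 1 - ‖z‖ ^ 2 := by nlinarith [norm_nonneg z]
  set s := 1 - ‖z‖ ^ 2 with hsdef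
  set G : En n → ℝ≥0∞ := fun w => ENNReal.ofReal ((1 - ‖w‖ ^ 2) ^ (t - 1) *
      (s / ‖(1 - inner ℂ z w : ℂ)‖ ^ 2) ^ (n + t)) * g w with hG
  have hEm : MeasurableSet {m : En n | qf z m < 1} := (isOpen_E z).measurableSet
  have hcv := lintegral_image_eq_lintegral_abs_det_fderiv_mul (volume : Measure (En n)) hEm
    (f := psi z) (f' := fun m => (psiD z m).restrictScalars ℝ)
    (fun m hm => ((psi_hasFDerivAt z m (inner_ne z m hz hm)).restrictScalars ℝ).hasFDerivWithinAt)
    (psi_inj z hz) G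
  have hsub : psi z '' {m | qf z m < 1} ⊆ ball 0 1 := by
    rintro _ ⟨m, hm, rfl⟩
    simpa using psi_mem z m hz hm
  refine le_trans (le_of_eq ?_) (lintegral_mono_set hsub)
  rw [hcv, ← lintegral_const_mul' _ _ ENNReal.ofReal_ne_top]
  refine setLIntegral_congr_fun hEm fun m hm => ?_
  have hd := inner_ne z m hz hm
  have hd' := norm_pos_iff.mpr hd
  simp only [hG]
  rw [psi_jac z m hz hd, one_sub_norm_psi z m hd, one_sub_inner_psi z m hd, ← mul_assoc,
    ← mul_assoc, ← ENNReal.ofReal_mul (by positivity), ← ENNReal.ofReal_mul (by positivity)]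
  congr 2
  rw [norm_div, Complex.norm_real, Real.norm_of_nonneg hs.le, ← hsdef]
  have hQ : 0 < 1 - qf z m := by
    have : qf z m < 1 := hm
    linarith
  set Q := 1 - qf z m
  set d := ‖(1 + inner ℂ z m : ℂ)‖
  have e1 : s / (s / d) ^ 2 = d ^ 2 / s := by field_simp
  rw [e1]
  have e2 : (n : ℝ) + t = (t - 1) + ((n + 1 : ℕ) : ℝ) := by push_cast; ring
  rw [e2, Real.rpow_add (by positivity), Real.rpow_natCast]
  have e3 : (s * Q / d ^ 2) ^ (t - 1) * (d ^ 2 / s) ^ (t - 1) = Q ^ (t - 1) := by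
    rw [← Real.mul_rpow (by positivity) (by positivity)]
    congr 1
    field_simp
  rw [← mul_assoc ((s * Q / d ^ 2) ^ (t - 1)), e3]
  obtain ⟨k, rfl⟩ := Nat.exists_eq_add_of_le' hn
  simp only [Nat.add_sub_cancel]
  rw [div_pow]
  field_simp
  ring

lemma step4 {n : ℕ} (hn : 1 ≤ n) (q : ℝ) (hq : 0 < q) (f : En n → l2)
    (hf : DifferentiableOn ℂ f (ball (0 : En n) 1))
    (z : En n) (hz : ‖z‖ < 1) : ∃ M : ℝ, 0 < M ∧ ∀ t : ℝ, 0 < t →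
    ENNReal.ofReal (‖f z‖ ^ q) *
      ∫⁻ y in ball (0 : En n) 1, ENNReal.ofReal ((1 - ‖y‖ ^ 2) ^ (t - 1)) ≤
    ENNReal.ofReal (M ^ t) * ∫⁻ w in ball (0 : En n) 1, ENNReal.ofReal ((1 - ‖w‖ ^ 2) ^ (t - 1)) *
      ENNReal.ofReal (((1 - ‖z‖ ^ 2) / ‖(1 - inner ℂ z w : ℂ)‖ ^ 2) ^ n * ‖f w‖ ^ q) := by
  have hs : 0 < 1 - ‖z‖ ^ 2 := by nlinarith [norm_nonneg z]
  have hz1 : 0 < 1 - ‖z‖ := by linarith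
  refine ⟨(1 - ‖z‖ ^ 2) / (1 - ‖z‖) ^ 2, by positivity, fun t ht => ?_⟩
  set M := (1 - ‖z‖ ^ 2) / (1 - ‖z‖) ^ 2 with hM
  rw [step1 hn z hz t]
  calc _ = ENNReal.ofReal ((1 - ‖z‖ ^ 2) ^ (n - 1)) * (ENNReal.ofReal (‖f z‖ ^ q) *
        ∫⁻ m in {m | qf z m < 1}, ENNReal.ofReal ((1 - qf z m) ^ (t - 1))) := by ring
    _ ≤ ENNReal.ofReal ((1 - ‖z‖ ^ 2) ^ (n - 1)) * _ := by
        gcongr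
        exact step2 q hq f hf z hz t
    _ ≤ _ := step3 hn z hz t (fun w => ENNReal.ofReal (‖f w‖ ^ q))
    _ ≤ _ := by
        rw [← lintegral_const_mul' _ _ ENNReal.ofReal_ne_top]
        refine setLIntegral_mono' measurableSet_ball fun w hw => ?_
        have hw1 : ‖w‖ < 1 := by simpa using hw
        have hb : 1 - ‖z‖ ≤ ‖(1 - inner ℂ z w : ℂ)‖ := by
          have h1 : ‖(inner ℂ z w : ℂ)‖ ≤ ‖z‖ := by
            refine (norm_inner_le_norm z w).trans ?_
            nlinarith [norm_nonneg z]
          have h2 := norm_sub_norm_le (1 : ℂ) (inner ℂ z w)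
          rw [norm_one] at h2
          linarith
        have hb0 : 0 < ‖(1 - inner ℂ z w : ℂ)‖ := by linarith
        set P := (1 - ‖z‖ ^ 2) / ‖(1 - inner ℂ z w : ℂ)‖ ^ 2 with hP
        have hP0 : 0 < P := by positivity
        have hPM : P ≤ M := by
          rw [hP, hM]; gcongr
        have hw2 : 0 < 1 - ‖w‖ ^ 2 := by nlinarith [norm_nonneg w]
        rw [← ENNReal.ofReal_mul (by positivity), ← ENNReal.ofReal_mul (by positivity),
          ← ENNReal.ofReal_mul (by positivity)]
        apply ENNReal.ofReal_le_ofReal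
        rw [Real.rpow_add hP0, Real.rpow_natCast]
        have : P ^ t ≤ M ^ t := Real.rpow_le_rpow hP0.le hPM ht.le
        calc _ = P ^ t * ((1 - ‖w‖ ^ 2) ^ (t - 1) * (P ^ n * ‖f w‖ ^ q)) := by ring
          _ ≤ _ := by gcongr

lemma polar_prod {n : ℕ} (hn : 1 ≤ n) (a : ℝ → ℝ≥0∞) (ha : Measurable a) (g : En n → ℝ≥0∞)
    (hg : Measurable fun ζ : sphere (0 : En n) 1 => g ζ) :
    ∫⁻ x : En n, a ‖x‖ * g (‖x‖⁻¹ • x) =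
      (∫⁻ ζ : sphere (0 : En n) 1, g ζ ∂(volume : Measure (En n)).toSphere) *
        ∫⁻ r : Ioi (0 : ℝ), a r ∂(Measure.volumeIoiPow (Module.finrank ℝ (En n) - 1)) := by
  have : NeZero n := ⟨by omega⟩
  calc ∫⁻ x : En n, a ‖x‖ * g (‖x‖⁻¹ • x)
      = ∫⁻ x : ({(0)}ᶜ : Set (En n)), a ‖x.1‖ * g (‖x.1‖⁻¹ • x.1)
          ∂((volume : Measure (En n)).comap (↑)) := by
        rw [lintegral_subtype_comap (measurableSet_singleton _).compl
          fun x : En n ↦ a ‖x‖ * g (‖x‖⁻¹ • x), restrict_compl_singleton]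
    _ = ∫⁻ x, a x.2 * g x.1 ∂(volume : Measure (En n)).toSphere.prod
          (.volumeIoiPow (Module.finrank ℝ (En n) - 1)) := by
        simpa using (volume : Measure (En n)).measurePreserving_homeomorphUnitSphereProd.lintegral_comp_emb
          (Homeomorph.measurableEmbedding _) (fun x => a x.2 * g x.1)
    _ = _ := by
        simp_rw [mul_comm (a _)]
        exact lintegral_prod_mul hg.aemeasurable (ha.comp measurable_subtype_coe).aemeasurable

lemma oneD (a t : ℝ) (ha : 0 ≤ a) (ha1 : a < 1) (ht : 0 < t) :
    ∫⁻ r in Ioo a 1, ENNReal.ofReal (r * (1 - r ^ 2) ^ (t - 1)) =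
      ENNReal.ofReal ((1 - a ^ 2) ^ t / (2 * t)) := by
  have hcont : ContinuousOn (fun r : ℝ => -((1 - r ^ 2) ^ t / (2 * t))) (Icc a 1) := by
    refine Continuous.continuousOn ?_
    have : Continuous fun r : ℝ => (1 - r ^ 2) ^ t :=
      Continuous.rpow_const (by fun_prop) (fun _ => Or.inr ht.le)
    fun_prop
  have hpos : ∀ r ∈ Ioo a 1, 0 < 1 - r ^ 2 := fun r hr => by
    have h1 := hr.1; have h2 := hr.2
    nlinarith
  have hder : ∀ r ∈ Ioo a 1, HasDerivAt (fun r : ℝ => -((1 - r ^ 2) ^ t / (2 * t)))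
      (r * (1 - r ^ 2) ^ (t - 1)) r := by
    intro r hr
    have h1 : HasDerivAt (fun r : ℝ => 1 - r ^ 2) (-(2 * r)) r := by
      simpa using ((hasDerivAt_id r).pow 2).const_sub 1
    have h2 := ((h1.rpow_const (p := t) (Or.inl (hpos r hr).ne')).div_const (2 * t)).neg
    refine h2.congr_deriv ?_
    field_simp
  have hnn : ∀ r ∈ Ioo a 1, 0 ≤ r * (1 - r ^ 2) ^ (t - 1) := fun r hr => by
    have := hpos r hr
    have : 0 ≤ r := ha.trans hr.1.le
    positivity
  have hint := intervalIntegral.integrableOn_deriv_of_nonneg hcont hder hnn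
  have hI := intervalIntegral.integral_eq_sub_of_hasDerivAt_of_le ha1.le hcont hder
    ((intervalIntegrable_iff_integrableOn_Ioc_of_le ha1.le).mpr hint)
  rw [intervalIntegral.integral_of_le ha1.le, integral_Ioc_eq_integral_Ioo] at hI
  rw [← ofReal_integral_eq_lintegral_ofReal (hint.mono_set Ioo_subset_Ioc_self), hI]
  · congr 1
    simp [Real.zero_rpow ht.ne']
  · exact (ae_restrict_iff' measurableSet_Ioo).mpr (Filter.Eventually.of_forall hnn)

/-- the radial weight -/
def radw (t : ℝ) : ℝ → ℝ≥0∞ := (Iio (1:ℝ)).indicator fun r => ENNReal.ofReal ((1 - r ^ 2) ^ (t - 1))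

lemma radw_meas (t : ℝ) : Measurable (radw t) :=
  Measurable.indicator (by fun_prop) measurableSet_Iio

lemma radw_int (t : ℝ) (N : ℕ) :
    ∫⁻ r : Ioi (0 : ℝ), radw t r ∂(Measure.volumeIoiPow N) =
      ∫⁻ r in Ioo 0 1, ENNReal.ofReal (r ^ N) * ENNReal.ofReal ((1 - r ^ 2) ^ (t - 1)) := by
  rw [Measure.volumeIoiPow, lintegral_withDensity_eq_lintegral_mul _ (by fun_prop)
    (g := fun r : Ioi (0:ℝ) => radw t r) ((radw_meas t).comp measurable_subtype_coe)]
  simp only [Pi.mul_apply]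
  rw [lintegral_subtype_comap measurableSet_Ioi (fun r => ENNReal.ofReal (r ^ N) * radw t r)]
  have : ∀ r : ℝ, ENNReal.ofReal (r ^ N) * radw t r = (Iio (1:ℝ)).indicator (fun r => 
      ENNReal.ofReal (r ^ N) * ENNReal.ofReal ((1 - r ^ 2) ^ (t - 1))) r := by
    intro r
    by_cases hr : r ∈ Iio (1:ℝ) <;> simp [radw, hr]
  simp_rw [this]
  rw [setLIntegral_indicator measurableSet_Iio, Iio_inter_Ioi]

lemma radw_upper (t : ℝ) (ht : 0 < t) (N : ℕ) (hN : 1 ≤ N) :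
    ∫⁻ r : Ioi (0 : ℝ), radw t r ∂(Measure.volumeIoiPow N) ≠ ⊤ := by
  rw [radw_int]
  refine ne_top_of_le_ne_top (ENNReal.ofReal_ne_top (r := (1 - 0 ^ 2) ^ t / (2 * t))) ?_
  rw [← oneD 0 t le_rfl one_pos ht]
  refine setLIntegral_mono' measurableSet_Ioo fun r hr => ?_
  have h0 := hr.1
  rw [← ENNReal.ofReal_mul (by positivity)]
  apply ENNReal.ofReal_le_ofReal
  have h1 : 0 < 1 - r ^ 2 := by have := hr.2; nlinarith
  gcongr
  exact pow_le_of_le_one h0.le hr.2.le (by omega)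

lemma radw_lower (t : ℝ) (ht : 0 < t) (ht1 : t ≤ 1) (N : ℕ) :
    ENNReal.ofReal ((1 / 2) ^ N * (3 / 8) / t) ≤
      ∫⁻ r : Ioi (0 : ℝ), radw t r ∂(Measure.volumeIoiPow N) := by
  rw [radw_int]
  calc _ ≤ ENNReal.ofReal ((1 / 2) ^ N) * ENNReal.ofReal ((1 - (1/2) ^ 2) ^ t / (2 * t)) := by
        rw [← ENNReal.ofReal_mul (by positivity)]
        apply ENNReal.ofReal_le_ofReal
        have : (3/4 : ℝ) ≤ (1 - (1/2) ^ 2) ^ t := by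
          have := Real.rpow_le_rpow_of_exponent_ge (x := 3/4) (by norm_num) (by norm_num) ht1
          rw [Real.rpow_one] at this
          norm_num at this ⊢
          exact this
        rw [mul_div_assoc]
        gcongr ?_ * ?_
        rw [div_le_div_iff₀ ht (by positivity)]
        nlinarith
    _ = ∫⁻ r in Ioo (1/2) 1, ENNReal.ofReal ((1 / 2) ^ N) *
          ENNReal.ofReal (r * (1 - r ^ 2) ^ (t - 1)) := by
        rw [lintegral_const_mul' _ _ ENNReal.ofReal_ne_top,
          oneD (1/2) t (by norm_num) (by norm_num) ht]
    _ ≤ ∫⁻ r in Ioo (1/2) 1, ENNReal.ofReal (r ^ N) * ENNReal.ofReal ((1 - r ^ 2) ^ (t - 1)) := by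
        refine setLIntegral_mono' measurableSet_Ioo fun r hr => ?_
        have h0 := hr.1
        have h2 := hr.2
        have h1 : 0 < 1 - r ^ 2 := by nlinarith
        have h3 : r * (1 - r ^ 2) ^ (t - 1) ≤ 1 * (1 - r ^ 2) ^ (t - 1) := by gcongr
        rw [one_mul] at h3
        gcongr
    _ ≤ _ := lintegral_mono_set (Ioo_subset_Ioo_left (by norm_num))

lemma finrank_En (n : ℕ) : Module.finrank ℝ (En n) = 2 * n := by
  rw [← Module.finrank_mul_finrank ℝ ℂ (En n), Complex.finrank_real_complex,
    finrank_euclideanSpace_fin]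

lemma ball_polar {n : ℕ} (hn : 1 ≤ n) (t : ℝ) (g : En n → ℝ≥0∞)
    (hg : Measurable fun ζ : sphere (0 : En n) 1 => g ζ) :
    ∫⁻ x in ball (0 : En n) 1, ENNReal.ofReal ((1 - ‖x‖ ^ 2) ^ (t - 1)) * g (‖x‖⁻¹ • x) =
      (∫⁻ ζ : sphere (0 : En n) 1, g ζ ∂(volume : Measure (En n)).toSphere) *
        ∫⁻ r : Ioi (0 : ℝ), radw t r ∂(Measure.volumeIoiPow (2 * n - 1)) := by
  have h := polar_prod hn (radw t) (radw_meas t) g hg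
  rw [finrank_En] at h
  rw [← h, ← lintegral_indicator measurableSet_ball]
  refine lintegral_congr fun x => ?_
  by_cases hx : ‖x‖ < 1
  · rw [indicator_of_mem (by simpa using hx), radw, indicator_of_mem (by simpa using hx)]
  · rw [indicator_of_notMem (by simpa using hx), radw, indicator_of_notMem (by simpa using hx),
      zero_mul]

lemma uc_bound {n : ℕ} (G : En n → ℝ) (hGc : ContinuousOn G (closedBall (0 : En n) 1))
    (ε : ℝ) (hε : 0 < ε) : ∃ D : ℝ, 0 ≤ D ∧ ∀ t : ℝ, 0 < t → ∀ w ∈ ball (0 : En n) 1,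
      ENNReal.ofReal ((1 - ‖w‖ ^ 2) ^ (t - 1)) * ENNReal.ofReal (G w) ≤
      ENNReal.ofReal ((1 - ‖w‖ ^ 2) ^ (t - 1)) * ENNReal.ofReal (G (‖w‖⁻¹ • w) + ε) +
        ENNReal.ofReal D := by
  have hcomp : IsCompact (closedBall (0 : En n) 1) := isCompact_closedBall _ _
  obtain ⟨C, hC⟩ := hcomp.exists_bound_of_continuousOn hGc
  have huc := hcomp.uniformContinuousOn_of_continuous hGc
  obtain ⟨δ, hδ, hδ'⟩ := Metric.uniformContinuousOn_iff.mp huc ε hε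
  have hC0 : 0 ≤ C := (norm_nonneg _).trans (hC 0 (by simp))
  set ρ : ℝ := max (1 - δ) 0 with hρ
  have hρ0 : 0 ≤ ρ := le_max_right _ _
  have hρ1 : ρ < 1 := max_lt (by linarith) one_pos
  have hρ2 : 0 < 1 - ρ ^ 2 := by nlinarith
  refine ⟨C * (1 - ρ ^ 2)⁻¹, by positivity, fun t ht w hw => ?_⟩
  have hw1 : ‖w‖ < 1 := by simpa using hw
  have hw2 : 0 < 1 - ‖w‖ ^ 2 := by nlinarith [norm_nonneg w]
  by_cases hcase : ‖w‖ ≤ ρ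
  · refine le_trans ?_ le_add_self
    rw [← ENNReal.ofReal_mul (by positivity)]
    apply ENNReal.ofReal_le_ofReal
    have h1 : G w ≤ C := (le_abs_self _).trans (hC w (by simpa using hw1.le))
    have h2 : (1 - ‖w‖ ^ 2) ^ (t - 1) ≤ (1 - ρ ^ 2)⁻¹ := by
      calc (1 - ‖w‖ ^ 2) ^ (t - 1) ≤ (1 - ‖w‖ ^ 2) ^ (-1 : ℝ) :=
            Real.rpow_le_rpow_of_exponent_ge hw2 (by nlinarith [norm_nonneg w]) (by linarith)
        _ = (1 - ‖w‖ ^ 2)⁻¹ := Real.rpow_neg_one _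
        _ ≤ _ := by gcongr
    calc _ ≤ (1 - ‖w‖ ^ 2) ^ (t - 1) * C := by gcongr
      _ ≤ (1 - ρ ^ 2)⁻¹ * C := by gcongr
      _ = _ := by ring
  · refine le_trans ?_ le_self_add
    gcongr
    push Not at hcase
    have hw0 : 0 < ‖w‖ := lt_of_le_of_lt hρ0 hcase
    have h3 : ‖‖w‖⁻¹ • w‖ = 1 := by
      rw [norm_smul, norm_inv, norm_norm, inv_mul_cancel₀ hw0.ne']
    have h4 : dist w (‖w‖⁻¹ • w) < δ := by
      have : w - ‖w‖⁻¹ • w = (1 - ‖w‖⁻¹) • w := by rw [sub_smul, one_smul]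
      rw [dist_eq_norm, this, norm_smul, Real.norm_eq_abs]
      have h5 : |1 - ‖w‖⁻¹| = ‖w‖⁻¹ - 1 := by
        rw [abs_sub_comm, abs_of_nonneg]
        have := one_le_inv₀ hw0 |>.mpr hw1.le
        linarith
      rw [h5, sub_mul, inv_mul_cancel₀ hw0.ne', one_mul]
      have := le_max_left (1 - δ) 0
      linarith
    have h6 := hδ' w (by simpa using hw1.le) (‖w‖⁻¹ • w) (by simp [h3]) h4
    rw [Real.dist_eq] at h6
    have := (abs_lt.mp h6).2
    linarith

open Filter in
lemma step5 {n : ℕ} (hn : 1 ≤ n) (G : En n → ℝ) (hGc : ContinuousOn G (closedBall (0 : En n) 1))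
    (X : ℝ≥0∞) (M : ℝ) (hM : 0 < M)
    (h : ∀ t : ℝ, 0 < t → X * ∫⁻ y in ball (0 : En n) 1, ENNReal.ofReal ((1 - ‖y‖ ^ 2) ^ (t - 1)) ≤
      ENNReal.ofReal (M ^ t) * ∫⁻ w in ball (0 : En n) 1,
        ENNReal.ofReal ((1 - ‖w‖ ^ 2) ^ (t - 1)) * ENNReal.ofReal (G w)) :
    X * (volume : Measure (En n)).toSphere univ ≤
      ∫⁻ ζ : sphere (0 : En n) 1, ENNReal.ofReal (G ζ) ∂(volume : Measure (En n)).toSphere := by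
  set τ := (volume : Measure (En n)).toSphere with hτ
  have hGs : Continuous fun ζ : sphere (0 : En n) 1 => G ζ :=
    hGc.comp_continuous continuous_subtype_val (fun ζ => sphere_subset_closedBall ζ.2)
  have key : ∀ ε : ℝ, 0 < ε → X * τ univ ≤
      ∫⁻ ζ : sphere (0 : En n) 1, ENNReal.ofReal (G ζ + ε) ∂τ := by
    intro ε hε
    obtain ⟨D, hD, hDle⟩ := uc_bound G hGc ε hε
    set S := ∫⁻ ζ : sphere (0 : En n) 1, ENNReal.ofReal (G ζ + ε) ∂τ with hS
    set V := ENNReal.ofReal D * (volume : Measure (En n)) (ball 0 1) with hV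
    have hVtop : V ≠ ⊤ := ENNReal.mul_ne_top ENNReal.ofReal_ne_top measure_ball_lt_top.ne
    set c : ℝ := (1 / 2) ^ (2 * n - 1) * (3 / 8) with hc
    have hc0 : 0 < c := by positivity
    have main : ∀ t : ℝ, 0 < t → t ≤ 1 →
        X * τ univ ≤ ENNReal.ofReal (M ^ t) * (S + V * ENNReal.ofReal (t / c)) := by
      intro t ht ht1
      set R := ∫⁻ r : Ioi (0 : ℝ), radw t r ∂(Measure.volumeIoiPow (2 * n - 1)) with hR
      have hRtop : R ≠ ⊤ := radw_upper t ht _ (by omega)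
      have hRlow : ENNReal.ofReal (c / t) ≤ R := radw_lower t ht ht1 _
      have hR0 : R ≠ 0 := by
        intro h0
        rw [h0] at hRlow
        have : 0 < ENNReal.ofReal (c / t) := ENNReal.ofReal_pos.mpr (by positivity)
        exact absurd hRlow (not_le.mpr this)
      have h1 : ∫⁻ y in ball (0 : En n) 1, ENNReal.ofReal ((1 - ‖y‖ ^ 2) ^ (t - 1)) = τ univ * R := by
        have := ball_polar hn t (fun _ => 1) measurable_const
        simp only [mul_one, lintegral_one] at this
        exact this
      have h2 : ∫⁻ w in ball (0 : En n) 1,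
          ENNReal.ofReal ((1 - ‖w‖ ^ 2) ^ (t - 1)) * ENNReal.ofReal (G w) ≤ S * R + V := by
        calc _ ≤ ∫⁻ w in ball (0 : En n) 1, (ENNReal.ofReal ((1 - ‖w‖ ^ 2) ^ (t - 1)) *
                ENNReal.ofReal (G (‖w‖⁻¹ • w) + ε) + ENNReal.ofReal D) :=
              setLIntegral_mono' measurableSet_ball (hDle t ht)
          _ = _ := by
              rw [lintegral_add_right _ measurable_const, setLIntegral_const,
                ball_polar hn t (fun w => ENNReal.ofReal (G w + ε))
                  (ENNReal.continuous_ofReal.comp (hGs.add_const ε)).measurable]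
      have h3 : V ≤ V * ENNReal.ofReal (t / c) * R := by
        calc V = V * (ENNReal.ofReal (t / c) * ENNReal.ofReal (c / t)) := by
              rw [← ENNReal.ofReal_mul (by positivity)]
              have : t / c * (c / t) = 1 := by field_simp
              rw [this]; simp
          _ ≤ V * (ENNReal.ofReal (t / c) * R) := by gcongr
          _ = _ := (mul_assoc _ _ _).symm
      refine (ENNReal.mul_le_mul_iff_left hR0 hRtop).mp ?_
      calc X * τ univ * R = X * (τ univ * R) := by ring
        _ ≤ ENNReal.ofReal (M ^ t) * (S * R + V) := by
            rw [← h1]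
            refine (h t ht).trans ?_
            gcongr
        _ ≤ ENNReal.ofReal (M ^ t) * (S * R + V * ENNReal.ofReal (t / c) * R) := by gcongr
        _ = _ := by ring
    have lim : Tendsto (fun t : ℝ => ENNReal.ofReal (M ^ t) * (S + V * ENNReal.ofReal (t / c)))
        (𝓝[>] 0) (𝓝 (1 * (S + V * 0))) := by
      have l1 : Tendsto (fun t : ℝ => ENNReal.ofReal (M ^ t)) (𝓝[>] 0) (𝓝 1) := by
        have : Continuous fun t : ℝ => ENNReal.ofReal (M ^ t) :=
          ENNReal.continuous_ofReal.comp (Real.continuous_const_rpow hM.ne')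
        have := (this.tendsto 0).mono_left (nhdsWithin_le_nhds (s := Ioi 0))
        simpa using this
      have l2 : Tendsto (fun t : ℝ => ENNReal.ofReal (t / c)) (𝓝[>] 0) (𝓝 0) := by
        have : Continuous fun t : ℝ => ENNReal.ofReal (t / c) :=
          ENNReal.continuous_ofReal.comp (by fun_prop)
        have := (this.tendsto 0).mono_left (nhdsWithin_le_nhds (s := Ioi 0))
        simpa using this
      refine ENNReal.Tendsto.mul l1 (Or.inl one_ne_zero) ?_ (Or.inr ENNReal.one_ne_top)
      exact tendsto_const_nhds.add (ENNReal.Tendsto.const_mul l2 (Or.inr hVtop))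
    rw [mul_zero, add_zero, one_mul] at lim
    refine ge_of_tendsto lim ?_
    have : Ioc (0:ℝ) 1 ∈ 𝓝[>] (0:ℝ) := Ioc_mem_nhdsGT one_pos
    filter_upwards [this] with t ht
    exact main t ht.1 ht.2
  have hτtop : τ univ ≠ ⊤ := measure_ne_top _ _
  have key2 : ∀ ε : ℝ, 0 < ε → X * τ univ ≤
      (∫⁻ ζ : sphere (0 : En n) 1, ENNReal.ofReal (G ζ) ∂τ) + ENNReal.ofReal ε * τ univ := by
    intro ε hε
    refine (key ε hε).trans ?_
    rw [← lintegral_const, ← lintegral_add_right _ measurable_const]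
    exact lintegral_mono fun ζ => ENNReal.ofReal_add_le
  have lim : Tendsto (fun ε : ℝ => (∫⁻ ζ : sphere (0 : En n) 1, ENNReal.ofReal (G ζ) ∂τ) +
      ENNReal.ofReal ε * τ univ) (𝓝[>] 0)
      (𝓝 ((∫⁻ ζ : sphere (0 : En n) 1, ENNReal.ofReal (G ζ) ∂τ) + 0 * τ univ)) := by
    have l2 : Tendsto (fun t : ℝ => ENNReal.ofReal t) (𝓝[>] 0) (𝓝 0) := by
      have := (ENNReal.continuous_ofReal.tendsto 0).mono_left (nhdsWithin_le_nhds (s := Ioi 0))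
      simpa using this
    exact tendsto_const_nhds.add (ENNReal.Tendsto.mul_const l2 (Or.inr hτtop))
  rw [zero_mul, add_zero] at lim
  refine ge_of_tendsto lim ?_
  filter_upwards [self_mem_nhdsWithin] with ε hε
  exact key2 ε hε

/-- Subharmonicity: for `0 < p < ∞` and `f` continuous on the closed ball and holomorphic on
`B_n` with values in `ℓ²`, `‖f(z)‖^{p/2}` is dominated by the invariant Poisson integral of
`‖f‖^{p/2}` over the sphere: `‖f(z)‖^{p/2} ≤ ∫_{∂B_n} ((1-|z|²)/|1-⟨z,ζ⟩|²)^n ‖f(ζ)‖^{p/2} dσ`. -/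
theorem norm_pow_le_invariant_poisson (n : ℕ) (hn : 1 ≤ n) (p : ℝ) (hp : 0 < p)
    (f : En n → l2)
    (hfc : ContinuousOn f (closedBall (0 : En n) 1))
    (hf : DifferentiableOn ℂ f (ball (0 : En n) 1))
    (z : En n) (hz : z ∈ ball (0 : En n) 1) :
    ‖f z‖ ^ (p / 2) ≤
      ∫ ζ : sphere (0 : En n) 1,
        ((1 - ‖z‖ ^ 2) / ‖1 - herm z (ζ : En n)‖ ^ 2) ^ n * ‖f (ζ : En n)‖ ^ (p / 2)
          ∂(sphereM n) := by
  have hz1 : ‖z‖ < 1 := by simpa using hz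
  have hq : 0 < p / 2 := by positivity
  have hs : 0 < 1 - ‖z‖ ^ 2 := by nlinarith [norm_nonneg z]
  have hnorm : ∀ w : En n, ‖1 - herm z w‖ = ‖(1 - inner ℂ z w : ℂ)‖ := by
    intro w
    rw [herm_eq_inner, ← inner_conj_symm, ← Complex.norm_conj]
    simp
  simp only [hnorm]
  obtain ⟨M, hM, hstep⟩ := step4 hn (p / 2) hq f hf z hz1
  set G : En n → ℝ := fun w =>
    ((1 - ‖z‖ ^ 2) / ‖(1 - inner ℂ z w : ℂ)‖ ^ 2) ^ n * ‖f w‖ ^ (p / 2) with hG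
  have hGc : ContinuousOn G (closedBall 0 1) := by
    refine ContinuousOn.mul (ContinuousOn.pow (ContinuousOn.div (by fun_prop) (by fun_prop) ?_) n)
      (ContinuousOn.rpow_const hfc.norm (fun _ _ => Or.inr hq.le))
    intro w hw
    have hw1 : ‖w‖ ≤ 1 := by simpa using hw
    have h1 : ‖(inner ℂ z w : ℂ)‖ ≤ ‖z‖ := by
      refine (norm_inner_le_norm z w).trans ?_
      nlinarith [norm_nonneg z]
    have h2 := norm_sub_norm_le (1 : ℂ) (inner ℂ z w)
    rw [norm_one] at h2
    have : 0 < ‖(1 - inner ℂ z w : ℂ)‖ := by linarith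
    positivity
  have hG0 : ∀ w, 0 ≤ G w := fun w => by positivity
  have h5 := step5 hn G hGc _ M hM hstep
  have hGs : Continuous fun ζ : sphere (0 : En n) 1 => G ζ :=
    hGc.comp_continuous continuous_subtype_val (fun ζ => sphere_subset_closedBall ζ.2)
  have : NeZero n := ⟨by omega⟩
  set τ := (volume : Measure (En n)).toSphere with hτ
  have hτtop : τ univ ≠ ⊤ := measure_ne_top _ _
  have hτ0 : τ univ ≠ 0 := by
    rw [Ne, Measure.measure_univ_eq_zero]
    exact Measure.toSphere_ne_zero _
  have hfin : IsFiniteMeasure (sphereM n) :=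
    Measure.smul_finite τ (ENNReal.inv_ne_top.mpr hτ0)
  have hint : Integrable (fun ζ : sphere (0 : En n) 1 => G ζ) (sphereM n) := by
    have := hGs.continuousOn.integrableOn_compact (μ := sphereM n) isCompact_univ
    simpa using this
  have hfinal : ENNReal.ofReal (‖f z‖ ^ (p / 2)) ≤
      ∫⁻ ζ : sphere (0 : En n) 1, ENNReal.ofReal (G ζ) ∂(sphereM n) := by
    rw [sphereM, lintegral_smul_measure, smul_eq_mul, mul_comm, ← div_eq_mul_inv]
    exact (ENNReal.le_div_iff_mul_le (Or.inl hτ0) (Or.inl hτtop)).mpr h5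
  rw [← ofReal_integral_eq_lintegral_ofReal hint
    (Filter.Eventually.of_forall fun ζ => hG0 _)] at hfinal
  exact (ENNReal.ofReal_le_ofReal_iff (integral_nonneg fun ζ => hG0 _)).mp hfinal
end
end
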